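/- arXiv:1602.02020 — 7 statements merged into one kernel-verified Lean document; each statement's English description precedes it below -/
import Mathlib

section
/- Invariant subspace property of the discrete EnKF iteration: if S denotes the linear span of the initial ensemble {u_0^{(j)}}_{j=1}^J, then for every n ≥ 0 and every j ∈ {1,…,J}, the iterate u_n^{(j)} produced by the EnKF update u_{n+1}^{(j)} = u_n^{(j)} + C^{up}(u_n)(C^{pp}(u_n) + h^{-1}Γ)^{-1}(y_{n+1}^{(j)} − G(u_n^{(j)})) belongs to S. -/
open scoped BigOperators
open RealInnerProductSpace

noncomputable section

/-- Ensemble mean. -/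
def ensMean {X : Type*} [AddCommGroup X] [Module ℝ X] {J : ℕ} (v : Fin J → X) : X :=
  (J : ℝ)⁻¹ • ∑ j, v j

/-- The empirical covariance operator `C^{pp}(u)` on `ℝ^K`, as a `K × K` matrix. -/
def cppMat {X : Type*} {K J : ℕ} (G : X → EuclideanSpace ℝ (Fin K)) (v : Fin J → X) :
    Matrix (Fin K) (Fin K) ℝ :=
  Matrix.of fun i i' =>
    (J : ℝ)⁻¹ * ∑ j, (G (v j) - ensMean fun k => G (v k)) i *
      (G (v j) - ensMean fun k => G (v k)) i'

/-- The operator `C^{up}(u) : ℝ^K → X` applied to `w`. -/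
def cupApp {X : Type*} [AddCommGroup X] [Module ℝ X] {K J : ℕ}
    (G : X → EuclideanSpace ℝ (Fin K)) (v : Fin J → X)
    (w : EuclideanSpace ℝ (Fin K)) : X :=
  (J : ℝ)⁻¹ • ∑ j, ⟪G (v j) - ensMean (fun k => G (v k)), w⟫ • (v j - ensMean v)

/-- Invariant subspace property of the discrete EnKF iteration. -/
theorem enkf_invariant_subspace
    {X : Type*} [NormedAddCommGroup X] [InnerProductSpace ℝ X]
    {K J : ℕ} (hJ : 0 < J)
    (G : X → EuclideanSpace ℝ (Fin K)) (hG : Continuous G)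
    (Γ : Matrix (Fin K) (Fin K) ℝ) (hΓ : Γ.PosDef)
    (h : ℝ) (hh : 0 < h)
    (ydata : ℕ → Fin J → EuclideanSpace ℝ (Fin K))
    (u : ℕ → Fin J → X)
    (hupdate : ∀ n j, u (n + 1) j = u n j +
      cupApp G (u n)
        (Matrix.toEuclideanLin (cppMat G (u n) + h⁻¹ • Γ)⁻¹
          (ydata (n + 1) j - G (u n j)))) :
    ∀ n j, u n j ∈ Submodule.span ℝ (Set.range (u 0)) := by
  intro n
  induction n with
  | zero => exact fun j => Submodule.subset_span ⟨j, rfl⟩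
  | succ n ih =>
    intro j
    rw [hupdate]
    refine Submodule.add_mem _ (ih j) ?_
    unfold cupApp
    refine Submodule.smul_mem _ _ (Submodule.sum_mem _ fun i _ => ?_)
    refine Submodule.smul_mem _ _ (Submodule.sub_mem _ (ih i) ?_)
    exact Submodule.smul_mem _ _ (Submodule.sum_mem _ fun k _ => ih k)

end
end

section
/- Global existence and uniqueness for the continuous-time EnKF flow with noise-free linear data: assume y = A u† for some truth u† ∈ X, let u^{(j)}(0) ∈ X for j = 1,…,J, and let X_0 be the linear span of {u^{(j)}(0)}_{j=1}^J. Then the ODE system du^{(j)}/dt = (1/J) Σ_{k=1}^J ⟨A(u^{(k)} − ū), y − A u^{(j)}⟩_Γ (u^{(k)} − ū) has a unique solution u^{(j)} ∈ C([0,∞); X_0) for j = 1,…,J; in particular the solution exists globally in time and remains in the subspace X_0 for all t ≥ 0. -/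
open scoped BigOperators
open RealInnerProductSpace Matrix

noncomputable section

/-- The Γ-weighted inner product `⟨a,b⟩_Γ = ⟨Γ⁻¹ a, b⟩` on `ℝ^K`. -/
def gInner {K : ℕ} (Γ : Matrix (Fin K) (Fin K) ℝ)
    (a b : EuclideanSpace ℝ (Fin K)) : ℝ :=
  ⟪Matrix.toEuclideanLin Γ⁻¹ a, b⟫

/-- Right-hand side of the continuous-time EnKF flow. -/
def enkfRHS {X : Type*} [NormedAddCommGroup X] [InnerProductSpace ℝ X] {K J : ℕ}
    (A : X →L[ℝ] EuclideanSpace ℝ (Fin K)) (Γ : Matrix (Fin K) (Fin K) ℝ)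
    (y : EuclideanSpace ℝ (Fin K)) (v : Fin J → X) (j : Fin J) : X :=
  (J : ℝ)⁻¹ • ∑ k, gInner Γ (A (v k - ensMean v)) (y - A (v j)) • (v k - ensMean v)

/-- `u : ℝ → Fin J → X` solves the continuous-time EnKF flow on `[0,∞)`. -/
def IsEnKFSolution {X : Type*} [NormedAddCommGroup X] [InnerProductSpace ℝ X] {K J : ℕ}
    (A : X →L[ℝ] EuclideanSpace ℝ (Fin K)) (Γ : Matrix (Fin K) (Fin K) ℝ)
    (y : EuclideanSpace ℝ (Fin K)) (u : ℝ → Fin J → X) : Prop :=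
  ∀ j : Fin J, ∀ t ∈ Set.Ici (0 : ℝ),
    HasDerivWithinAt (fun s => u s j) (enkfRHS A Γ y (u t) j) (Set.Ici 0) t

/-- The deviation Gram matrix `E` of an ensemble. -/
def matE {X : Type*} [NormedAddCommGroup X] [InnerProductSpace ℝ X] {K J : ℕ}
    (A : X →L[ℝ] EuclideanSpace ℝ (Fin K)) (Γ : Matrix (Fin K) (Fin K) ℝ)
    (v : Fin J → X) : Matrix (Fin J) (Fin J) ℝ :=
  Matrix.of fun l j => gInner Γ (A (v l - ensMean v)) (A (v j - ensMean v))

/-- The residual/deviation cross Gram matrix `F` of an ensemble. -/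
def matF {X : Type*} [NormedAddCommGroup X] [InnerProductSpace ℝ X] {K J : ℕ}
    (A : X →L[ℝ] EuclideanSpace ℝ (Fin K)) (Γ : Matrix (Fin K) (Fin K) ℝ)
    (udag : X) (v : Fin J → X) : Matrix (Fin J) (Fin J) ℝ :=
  Matrix.of fun l j => gInner Γ (A (v l - udag)) (A (v j - ensMean v))

/-- The residual Gram matrix `R` of an ensemble. -/
def matR {X : Type*} [NormedAddCommGroup X] [InnerProductSpace ℝ X] {K J : ℕ}
    (A : X →L[ℝ] EuclideanSpace ℝ (Fin K)) (Γ : Matrix (Fin K) (Fin K) ℝ)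
    (udag : X) (v : Fin J → X) : Matrix (Fin J) (Fin J) ℝ :=
  Matrix.of fun l j => gInner Γ (A (v l - udag)) (A (v j - udag))

/-- The orthogonal complement of a subspace of `ℝ^K` w.r.t. the Γ-weighted inner product. -/
def gOrth {K : ℕ} (Γ : Matrix (Fin K) (Fin K) ℝ)
    (S : Submodule ℝ (EuclideanSpace ℝ (Fin K))) :
    Submodule ℝ (EuclideanSpace ℝ (Fin K)) where
  carrier := {w | ∀ v ∈ S, gInner Γ v w = 0}
  add_mem' := by
    intro a b ha hb v hv
    have h1 := ha v hv
    have h2 := hb v hv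
    simp only [gInner, Set.mem_setOf_eq] at *
    rw [inner_add_right, h1, h2, add_zero]
  zero_mem' := by
    intro v hv
    simp [gInner]
  smul_mem' := by
    intro c a ha v hv
    have h1 := ha v hv
    simp only [gInner, Set.mem_setOf_eq] at *
    rw [inner_smul_right, h1, mul_zero]

/-- The orthogonal complement of a subspace of `X` w.r.t. the inner product
`⟨v,w⟩_* = ⟨A v, A w⟩_Γ`. -/
def gOrthX {X : Type*} [NormedAddCommGroup X] [InnerProductSpace ℝ X] {K : ℕ}
    (A : X →L[ℝ] EuclideanSpace ℝ (Fin K)) (Γ : Matrix (Fin K) (Fin K) ℝ)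
    (S : Submodule ℝ X) : Submodule ℝ X where
  carrier := {w | ∀ v ∈ S, gInner Γ (A v) (A w) = 0}
  add_mem' := by
    intro a b ha hb v hv
    have h1 := ha v hv
    have h2 := hb v hv
    simp only [gInner, Set.mem_setOf_eq, map_add] at *
    rw [inner_add_right, h1, h2, add_zero]
  zero_mem' := by
    intro v hv
    simp [gInner]
  smul_mem' := by
    intro c a ha v hv
    have h1 := ha v hv
    simp only [gInner, Set.mem_setOf_eq, _root_.map_smul] at *
    rw [inner_smul_right, h1, mul_zero]



theorem aux_ode_unique {V : Type*} [NormedAddCommGroup V] [NormedSpace ℝ V]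
    [FiniteDimensional ℝ V] (f : V → V) (hf : ContDiff ℝ 1 f) (T : ℝ) (u v : ℝ → V)
    (h0 : u 0 = v 0)
    (hu : ∀ t ∈ Set.Icc 0 T, HasDerivWithinAt u (f (u t)) (Set.Icc 0 T) t)
    (hv : ∀ t ∈ Set.Icc 0 T, HasDerivWithinAt v (f (v t)) (Set.Icc 0 T) t) :
    Set.EqOn u v (Set.Icc 0 T) := by
  have : ProperSpace V := FiniteDimensional.proper ℝ V
  have hcu : ContinuousOn u (Set.Icc 0 T) := fun t ht => (hu t ht).continuousWithinAt
  have hcv : ContinuousOn v (Set.Icc 0 T) := fun t ht => (hv t ht).continuousWithinAt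
  obtain ⟨K, hK⟩ : ∃ K, LipschitzOnWith K f (u '' Set.Icc 0 T ∪ v '' Set.Icc 0 T) :=
    (hf.locallyLipschitz.locallyLipschitzOn).exists_lipschitzOnWith_of_compact
      ((isCompact_Icc.image_of_continuousOn hcu).union (isCompact_Icc.image_of_continuousOn hcv))
  refine ODE_solution_unique_of_mem_Icc_right (v := fun _ => f)
    (s := fun _ => u '' Set.Icc 0 T ∪ v '' Set.Icc 0 T) (fun _ _ => hK) hcu ?_ ?_ hcv ?_ ?_ h0
  · intro t ht
    exact (hu t ⟨ht.1, ht.2.le⟩).mono_of_mem_nhdsWithin (Icc_mem_nhdsGE_of_mem ht)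
  · intro t ht
    exact Or.inl ⟨t, ⟨ht.1, ht.2.le⟩, rfl⟩
  · intro t ht
    exact (hv t ⟨ht.1, ht.2.le⟩).mono_of_mem_nhdsWithin (Icc_mem_nhdsGE_of_mem ht)
  · intro t ht
    exact Or.inr ⟨t, ⟨ht.1, ht.2.le⟩, rfl⟩

theorem aux_ode_exists {V : Type*} [NormedAddCommGroup V] [NormedSpace ℝ V]
    [FiniteDimensional ℝ V] (f : V → V) (hf : ContDiff ℝ 1 f) (x0 : V) (C : ℝ) (hC : 0 ≤ C)
    (hb : ∀ χ : V → ℝ, (∀ x, 0 ≤ χ x) → (∀ x, χ x ≤ 1) → ∀ (T : ℝ) (w : ℝ → V), w 0 = x0 →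
      (∀ t ∈ Set.Icc 0 T, HasDerivWithinAt w (χ (w t) • f (w t)) (Set.Icc 0 T) t) →
      ∀ t ∈ Set.Icc 0 T, ‖w t‖ ≤ ‖x0‖ * Real.exp (C * t)) (T : ℝ) (hT : 0 ≤ T) :
    ∃ w : ℝ → V, w 0 = x0 ∧
      ∀ t ∈ Set.Icc 0 T, HasDerivWithinAt w (f (w t)) (Set.Icc 0 T) t := by
  have : ProperSpace V := FiniteDimensional.proper ℝ V
  have : CompleteSpace V := FiniteDimensional.complete ℝ V
  set R : ℝ := ‖x0‖ * Real.exp (C * T) + 1 with hR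
  have hR0 : 0 < R := by positivity
  let χ : ContDiffBump (0 : V) := ⟨R, R + 1, hR0, by linarith⟩
  have hcd : ContDiff ℝ 1 (fun x => χ x • f x) := χ.contDiff.smul hf
  have hcs : HasCompactSupport (fun x => χ x • f x) := χ.hasCompactSupport.smul_right
  obtain ⟨K, hK⟩ := ContDiff.lipschitzWith_of_hasCompactSupport hcs hcd one_ne_zero
  obtain ⟨L, hL⟩ := hcs.exists_bound_of_continuous hcd.continuous
  have hpl : IsPicardLindelof (fun _ : ℝ => fun x => χ x • f x)
      (⟨0, le_refl 0, hT⟩ : Set.Icc (0:ℝ) T) x0 (L.toNNReal * T.toNNReal) 0 L.toNNReal K := by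
    refine ⟨fun _ _ => hK.lipschitzOnWith, fun _ _ => continuousOn_const, ?_, ?_⟩
    · intro t _ x _
      exact (hL x).trans (Real.le_coe_toNNReal L)
    · simp [hT]
  obtain ⟨w, hw0, hw⟩ := hpl.exists_eq_forall_mem_Icc_hasDerivWithinAt₀
  refine ⟨w, hw0, fun t ht => ?_⟩
  have h1 := hb χ (fun x => χ.nonneg) (fun x => χ.le_one) T w hw0 hw t ht
  have h2 : χ (w t) = 1 := by
    apply χ.one_of_mem_closedBall
    rw [mem_closedBall_zero_iff]
    refine h1.trans ?_
    have : Real.exp (C * t) ≤ Real.exp (C * T) :=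
      Real.exp_le_exp.2 (mul_le_mul_of_nonneg_left ht.2 hC)
    have := mul_le_mul_of_nonneg_left this (norm_nonneg x0)
    show _ ≤ R
    linarith
  have h3 := hw t ht
  simpa [h2] using h3

theorem aux_ode_global {V : Type*} [NormedAddCommGroup V] [NormedSpace ℝ V]
    [FiniteDimensional ℝ V] (f : V → V) (hf : ContDiff ℝ 1 f) (x0 : V)
    (hex : ∀ T : ℝ, 0 ≤ T → ∃ w : ℝ → V, w 0 = x0 ∧
      ∀ t ∈ Set.Icc 0 T, HasDerivWithinAt w (f (w t)) (Set.Icc 0 T) t) :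
    ∃ u : ℝ → V, u 0 = x0 ∧ ∀ t ∈ Set.Ici (0:ℝ), HasDerivWithinAt u (f (u t)) (Set.Ici 0) t := by
  choose w hw0 hw using fun n : ℕ => hex n n.cast_nonneg
  have hag : ∀ (m n : ℕ) (t : ℝ), 0 ≤ t → t ≤ m → t ≤ n → w m t = w n t := by
    intro m n t h0 hm hn
    refine aux_ode_unique f hf t (w m) (w n) (by rw [hw0, hw0]) ?_ ?_ ⟨h0, le_rfl⟩
    · intro s hs
      exact (hw m s ⟨hs.1, hs.2.trans hm⟩).mono (Set.Icc_subset_Icc_right hm)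
    · intro s hs
      exact (hw n s ⟨hs.1, hs.2.trans hn⟩).mono (Set.Icc_subset_Icc_right hn)
  have hu : ∀ (n : ℕ) (t : ℝ), 0 ≤ t → t ≤ n → w ⌈t⌉₊ t = w n t := fun n t h0 hn =>
    hag _ _ t h0 (Nat.le_ceil t) hn
  refine ⟨fun t => w ⌈t⌉₊ t, by simp [hw0], fun t ht => ?_⟩
  have ht0 : (0:ℝ) ≤ t := ht
  obtain ⟨n, hn⟩ := exists_nat_gt t
  have h1 := hw n t ⟨ht0, hn.le⟩
  have h2 : HasDerivWithinAt (w n) (f (w n t)) (Set.Ici 0) t := by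
    refine h1.mono_of_mem_nhdsWithin ?_
    rw [← Set.Ici_inter_Iic]
    exact Filter.inter_mem self_mem_nhdsWithin (mem_nhdsWithin_of_mem_nhds (Iic_mem_nhds hn))
  have h3 : w ⌈t⌉₊ t = w n t := hu n t ht0 hn.le
  show HasDerivWithinAt _ (f (w ⌈t⌉₊ t)) _ _
  rw [h3]
  refine h2.congr_of_eventuallyEq ?_ h3
  filter_upwards [self_mem_nhdsWithin, mem_nhdsWithin_of_mem_nhds (Iic_mem_nhds hn)] with s hs hs'
  exact hu n s hs hs'

theorem aux_gInner {K : ℕ} (Γ : Matrix (Fin K) (Fin K) ℝ) (hΓ : Γ.PosDef) :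
    ∃ B : EuclideanSpace ℝ (Fin K) →L[ℝ] EuclideanSpace ℝ (Fin K),
      ∀ a b, gInner Γ a b = ⟪B a, B b⟫ := by
  obtain ⟨S, hS⟩ : ∃ S : Matrix (Fin K) (Fin K) ℝ, Γ⁻¹ = Sᴴ * S := by
    open scoped MatrixOrder Matrix.Norms.L2Operator in
    exact CStarAlgebra.nonneg_iff_eq_star_mul_self.mp hΓ.inv.posSemidef.nonneg
  refine ⟨LinearMap.toContinuousLinearMap (Matrix.toEuclideanLin S), fun a b => ?_⟩
  simp only [gInner, hS, LinearMap.coe_toContinuousLinearMap']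
  rw [← LinearMap.adjoint_inner_left, ← Matrix.toEuclideanLin_conjTranspose_eq_adjoint]
  congr 1
  simp [Matrix.toLpLin_apply]

theorem aux_contDiff {E : Type*} [NormedAddCommGroup E] [InnerProductSpace ℝ E] {K J : ℕ}
    (A : E →L[ℝ] EuclideanSpace ℝ (Fin K)) (Γ : Matrix (Fin K) (Fin K) ℝ)
    (y : EuclideanSpace ℝ (Fin K))
    (B : EuclideanSpace ℝ (Fin K) →L[ℝ] EuclideanSpace ℝ (Fin K))
    (hB : ∀ a b, gInner Γ a b = ⟪B a, B b⟫) :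
    ContDiff ℝ 1 (fun v : Fin J → E => enkfRHS A Γ y v) := by
  rw [contDiff_pi]
  intro j
  have h : ∀ k : Fin J, ContDiff ℝ 1 (fun v : Fin J → E => v k) := fun k => contDiff_apply ℝ E k
  have hm : ContDiff ℝ 1 (fun v : Fin J → E => ensMean v) := by
    unfold ensMean
    exact (ContDiff.sum fun k _ => h k).const_smul _
  unfold enkfRHS
  simp only [hB]
  refine ContDiff.const_smul _ (ContDiff.sum fun k _ => ?_)
  refine ContDiff.smul ?_ ((h k).sub hm)
  refine ContDiff.inner ℝ ?_ ?_
  · exact B.contDiff.comp (A.contDiff.comp ((h k).sub hm))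
  · exact B.contDiff.comp (contDiff_const.sub (A.contDiff.comp (h j)))

theorem aux_dissip {E : Type*} [NormedAddCommGroup E] [InnerProductSpace ℝ E] {K J : ℕ}
    (A : E →L[ℝ] EuclideanSpace ℝ (Fin K)) (Γ : Matrix (Fin K) (Fin K) ℝ)
    (y : EuclideanSpace ℝ (Fin K))
    (B : EuclideanSpace ℝ (Fin K) →L[ℝ] EuclideanSpace ℝ (Fin K))
    (hB : ∀ a b, gInner Γ a b = ⟪B a, B b⟫) (v : Fin J → E) (j : Fin J) :
    0 ≤ ⟪B (y - A (v j)), B (A (enkfRHS A Γ y v j))⟫ := by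
  unfold enkfRHS
  simp only [hB, map_smul, map_sum, inner_smul_right, inner_sum]
  refine mul_nonneg (by positivity) (Finset.sum_nonneg fun k _ => ?_)
  rw [real_inner_comm]
  exact mul_self_nonneg _

theorem aux_mean_norm {E : Type*} [NormedAddCommGroup E] [NormedSpace ℝ E] {J : ℕ} (hJ : 0 < J)
    (v : Fin J → E) (M : ℝ) (h : ∀ j, ‖v j‖ ≤ M) : ‖(J : ℝ)⁻¹ • ∑ j, v j‖ ≤ M := by
  have hJ' : (0:ℝ) < J := by exact_mod_cast hJ
  rw [norm_smul, norm_inv, Real.norm_natCast, inv_mul_le_iff₀ hJ']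
  calc ‖∑ j, v j‖ ≤ ∑ j : Fin J, M := norm_sum_le_of_le _ fun j _ => h j
    _ = J * M := by simp

theorem aux_growth {E : Type*} [NormedAddCommGroup E] [InnerProductSpace ℝ E] {K J : ℕ}
    (hJ : 0 < J)
    (A : E →L[ℝ] EuclideanSpace ℝ (Fin K)) (Γ : Matrix (Fin K) (Fin K) ℝ)
    (y : EuclideanSpace ℝ (Fin K))
    (B : EuclideanSpace ℝ (Fin K) →L[ℝ] EuclideanSpace ℝ (Fin K))
    (hB : ∀ a b, gInner Γ a b = ⟪B a, B b⟫) (v : Fin J → E) (M : ℝ) (hM0 : 0 ≤ M)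
    (hM : ∀ j, ‖B (y - A (v j))‖ ≤ M) :
    ‖enkfRHS A Γ y v‖ ≤ (4 * M ^ 2) * ‖v‖ := by
  have hJ' : (J:ℝ) ≠ 0 := by exact_mod_cast hJ.ne'
  rw [pi_norm_le_iff_of_nonneg (by positivity)]
  intro j
  unfold enkfRHS
  refine aux_mean_norm hJ (fun k => gInner Γ (A (v k - ensMean v)) (y - A (v j)) •
    (v k - ensMean v)) _ fun k => ?_
  have h1 : ‖v k - ensMean v‖ ≤ 2 * ‖v‖ := by
    have := norm_sub_le (v k) (ensMean v)
    have := aux_mean_norm hJ v ‖v‖ (norm_le_pi_norm v)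
    have := norm_le_pi_norm v k
    unfold ensMean at *
    linarith
  have h2 : ‖B (A (v k - ensMean v))‖ ≤ 2 * M := by
    have e : B (A (v k - ensMean v)) =
        (J : ℝ)⁻¹ • (∑ l, B (y - A (v l))) - B (y - A (v k)) := by
      simp only [ensMean, map_sub, map_smul, map_sum, Finset.sum_sub_distrib, smul_sub,
        Finset.sum_const, Finset.card_univ, Fintype.card_fin]
      rw [← Nat.cast_smul_eq_nsmul ℝ, smul_smul, inv_mul_cancel₀ hJ', one_smul]
      abel
    rw [e]
    have := norm_sub_le ((J : ℝ)⁻¹ • (∑ l, B (y - A (v l)))) (B (y - A (v k)))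
    have := aux_mean_norm hJ (fun l => B (y - A (v l))) M hM
    have := hM k
    linarith
  rw [norm_smul, hB]
  have h3 : ‖⟪B (A (v k - ensMean v)), B (y - A (v j))⟫‖ ≤ 2 * M * M :=
    (norm_inner_le_norm _ _).trans (mul_le_mul h2 (hM j) (norm_nonneg _) (by positivity))
  calc _ ≤ (2 * M * M) * (2 * ‖v‖) := mul_le_mul h3 h1 (norm_nonneg _) (by positivity)
    _ = _ := by ring

theorem aux_bound {E : Type*} [NormedAddCommGroup E] [InnerProductSpace ℝ E] {K J : ℕ}
    (hJ : 0 < J)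
    (A : E →L[ℝ] EuclideanSpace ℝ (Fin K)) (Γ : Matrix (Fin K) (Fin K) ℝ)
    (y : EuclideanSpace ℝ (Fin K))
    (B : EuclideanSpace ℝ (Fin K) →L[ℝ] EuclideanSpace ℝ (Fin K))
    (hB : ∀ a b, gInner Γ a b = ⟪B a, B b⟫) (x0 : Fin J → E) (M : ℝ) (hM0 : 0 ≤ M)
    (hM : ∀ j, ‖B (y - A (x0 j))‖ ≤ M)
    (χ : (Fin J → E) → ℝ) (hχ0 : ∀ x, 0 ≤ χ x) (hχ1 : ∀ x, χ x ≤ 1) (T : ℝ)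
    (w : ℝ → Fin J → E) (hw0 : w 0 = x0)
    (hw : ∀ t ∈ Set.Icc 0 T,
      HasDerivWithinAt w (χ (w t) • enkfRHS A Γ y (w t)) (Set.Icc 0 T) t) :
    ∀ t ∈ Set.Icc 0 T, ‖w t‖ ≤ ‖x0‖ * Real.exp (4 * M ^ 2 * t) := by
  have hcw : ContinuousOn w (Set.Icc 0 T) := fun t ht => (hw t ht).continuousWithinAt
  have hres : ∀ j, ∀ t ∈ Set.Icc 0 T, ‖B (y - A (w t j))‖ ≤ M := by
    intro j t ht
    have hd : ∀ s ∈ Set.Icc 0 T, HasDerivWithinAt (fun s => ‖B (y - A (w s j))‖ ^ 2)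
        (2 * ⟪B (y - A (w s j)), B (0 - A (χ (w s) • enkfRHS A Γ y (w s) j))⟫)
        (Set.Icc 0 T) s := by
      intro s hs
      have h1 := (hasDerivWithinAt_pi.1 (hw s hs)) j
      have h2 := A.hasFDerivAt.comp_hasDerivWithinAt s h1
      have h3 := (hasDerivWithinAt_const s (Set.Icc 0 T) y).sub h2
      have h4 := B.hasFDerivAt.comp_hasDerivWithinAt s h3
      exact h4.norm_sq
    have hanti : AntitoneOn (fun s => ‖B (y - A (w s j))‖ ^ 2) (Set.Icc 0 T) := by
      refine antitoneOn_of_hasDerivWithinAt_nonpos (convex_Icc 0 T)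
        (fun s hs => (hd s hs).continuousWithinAt)
        (fun s hs => (hd s (interior_subset hs)).mono interior_subset) ?_
      intro s _
      have h := mul_nonneg (hχ0 (w s)) (aux_dissip A Γ y B hB (w s) j)
      rw [zero_sub, map_neg, inner_neg_right, map_smul, map_smul, inner_smul_right]
      linarith
    have h := hanti ⟨le_rfl, ht.1.trans ht.2⟩ ht ht.1
    simp only [hw0] at h
    exact (pow_le_pow_iff_left₀ (norm_nonneg _) (norm_nonneg _) two_ne_zero |>.1 h).trans (hM j)
  intro t ht
  have := norm_le_gronwallBound_of_norm_deriv_right_le (f := w)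
    (f' := fun t => χ (w t) • enkfRHS A Γ y (w t)) (δ := ‖x0‖) (K := 4 * M ^ 2) (ε := 0)
    (a := 0) (b := T) hcw
    (fun s hs => (hw s ⟨hs.1, hs.2.le⟩).mono_of_mem_nhdsWithin (Icc_mem_nhdsGE_of_mem hs))
    (by rw [hw0]) (fun s hs => ?_) t ht
  · simpa [gronwallBound_ε0] using this
  · have h := aux_growth hJ A Γ y B hB (w s) M hM0 (fun j => hres j s ⟨hs.1, hs.2.le⟩)
    rw [norm_smul, Real.norm_of_nonneg (hχ0 _), add_zero]
    exact (mul_le_of_le_one_left (norm_nonneg _) (hχ1 _)).trans h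

theorem aux_coe {X : Type*} [NormedAddCommGroup X] [InnerProductSpace ℝ X] {K J : ℕ}
    (A : X →L[ℝ] EuclideanSpace ℝ (Fin K)) (Γ : Matrix (Fin K) (Fin K) ℝ)
    (y : EuclideanSpace ℝ (Fin K)) (E : Submodule ℝ X) (v : Fin J → E) (j : Fin J) :
    ((enkfRHS (A.comp E.subtypeL) Γ y v j : E) : X) = enkfRHS A Γ y (fun k => (v k : X)) j := by
  simp [enkfRHS, ensMean]

theorem enkf_flow_global_existence_uniqueness
    {X : Type*} [NormedAddCommGroup X] [InnerProductSpace ℝ X]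
    {K J : ℕ} (hJ : 2 ≤ J)
    (A : X →L[ℝ] EuclideanSpace ℝ (Fin K))
    (Γ : Matrix (Fin K) (Fin K) ℝ) (hΓ : Γ.PosDef)
    (udag : X) (u0 : Fin J → X) :
    ∃ u : ℝ → Fin J → X,
      ((∀ j, u 0 j = u0 j) ∧
        (∀ j, ContinuousOn (fun t => u t j) (Set.Ici 0)) ∧
        IsEnKFSolution A Γ (A udag) u ∧
        (∀ j, ∀ t ∈ Set.Ici (0 : ℝ), u t j ∈ Submodule.span ℝ (Set.range u0))) ∧
      ∀ v : ℝ → Fin J → X,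
        ((∀ j, v 0 j = u0 j) ∧
          (∀ j, ContinuousOn (fun t => v t j) (Set.Ici 0)) ∧
          IsEnKFSolution A Γ (A udag) v ∧
          (∀ j, ∀ t ∈ Set.Ici (0 : ℝ), v t j ∈ Submodule.span ℝ (Set.range u0))) →
        ∀ j, ∀ t ∈ Set.Ici (0 : ℝ), v t j = u t j := by
  obtain ⟨B, hB⟩ := aux_gInner Γ hΓ
  have hJ0 : 0 < J := by omega
  generalize A udag = y
  have hmem : ∀ j, u0 j ∈ Submodule.span ℝ (Set.range u0) := fun j =>
    Submodule.subset_span ⟨j, rfl⟩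
  have hfin : FiniteDimensional ℝ (Submodule.span ℝ (Set.range u0)) :=
    FiniteDimensional.span_of_finite ℝ (Set.finite_range u0)
  generalize Submodule.span ℝ (Set.range u0) = E at hmem hfin ⊢
  set A' := A.comp E.subtypeL with hA'
  let x0 : Fin J → E := fun j => ⟨u0 j, hmem j⟩
  have hcd := aux_contDiff (J := J) A' Γ y B hB
  set M : ℝ := ∑ j, ‖B (y - A' (x0 j))‖ with hMdef
  have hM0 : 0 ≤ M := Finset.sum_nonneg fun _ _ => norm_nonneg _
  have hM : ∀ j, ‖B (y - A' (x0 j))‖ ≤ M := fun j =>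
    Finset.single_le_sum (f := fun j => ‖B (y - A' (x0 j))‖) (fun _ _ => norm_nonneg _)
      (Finset.mem_univ j)
  obtain ⟨w, hw0, hw⟩ := aux_ode_global _ hcd x0
    (aux_ode_exists _ hcd x0 (4 * M ^ 2) (by positivity)
      (aux_bound hJ0 A' Γ y B hB x0 M hM0 hM))
  have hsol : IsEnKFSolution A Γ y (fun t j => (w t j : X)) := by
    intro j t ht
    have h := E.subtypeL.hasFDerivAt.comp_hasDerivWithinAt t (hasDerivWithinAt_pi.1 (hw t ht) j)
    rw [← aux_coe]
    exact h
  refine ⟨fun t j => (w t j : X), ⟨?_, ?_, hsol, fun j t _ => (w t j).2⟩, ?_⟩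
  · intro j
    simp [hw0, x0]
  · intro j t ht
    exact (hsol j t ht).continuousWithinAt
  · rintro v ⟨hv0, -, hv, hvE⟩ j t ht
    let P := E.orthogonalProjectionOnto
    let v' : ℝ → Fin J → E := fun s j => P (v s j)
    have hPv : ∀ s ∈ Set.Ici (0:ℝ), ∀ j, (v' s j : X) = v s j := fun s hs j =>
      Submodule.starProjection_eq_self_iff.2 (hvE j s hs)
    have hd : ∀ s ∈ Set.Ici (0:ℝ),
        HasDerivWithinAt v' (enkfRHS A' Γ y (v' s)) (Set.Ici 0) s := by
      intro s hs
      rw [hasDerivWithinAt_pi]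
      intro k
      have h := P.hasFDerivAt.comp_hasDerivWithinAt s (hv k s hs)
      have e : P (enkfRHS A Γ y (v s) k) = enkfRHS A' Γ y (v' s) k := by
        have e1 : v s = fun k => (v' s k : X) := funext fun k => (hPv s hs k).symm
        rw [e1, ← aux_coe]
        exact Submodule.orthogonalProjectionOnto_mem_subspace_eq_self _
      rw [← e]
      exact h
    have h00 : v' 0 = w 0 := by
      rw [hw0]
      funext k
      apply Subtype.ext
      rw [hPv 0 (le_refl (0:ℝ)) k, hv0]
    have heq := aux_ode_unique _ hcd t v' w h00
      (fun s hs => (hd s hs.1).mono Set.Icc_subset_Ici_self)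
      (fun s hs => (hw s hs.1).mono Set.Icc_subset_Ici_self) (⟨ht, le_rfl⟩ : t ∈ Set.Icc 0 t)
    rw [← hPv t ht j, heq]

end
end

section
/- Ensemble collapse at an algebraic rate: assume y = A u† for some truth u† ∈ X and let u = (u^{(1)},…,u^{(J)}) solve the continuous-time EnKF flow on [0,∞). Then the matrix E(t) converges to 0 as t → ∞ and ‖E(t)‖ = O(J t^{-1}); quantitatively, every eigenvalue of E(t) is bounded above by (2t/J)^{-1} = J/(2t), so the spectral norm satisfies ‖E(t)‖ ≤ J/(2t) for all t > 0. -/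
open scoped BigOperators
open RealInnerProductSpace Matrix

noncomputable section

lemma gInner_sum_right' {K : ℕ} {ι : Type*} (Γ : Matrix (Fin K) (Fin K) ℝ)
    (a : EuclideanSpace ℝ (Fin K)) (s : Finset ι) (f : ι → EuclideanSpace ℝ (Fin K)) :
    gInner Γ a (∑ i ∈ s, f i) = ∑ i ∈ s, gInner Γ a (f i) := by
  simp [gInner, inner_sum]

lemma gInner_sum_left' {K : ℕ} {ι : Type*} (Γ : Matrix (Fin K) (Fin K) ℝ)
    (a : EuclideanSpace ℝ (Fin K)) (s : Finset ι) (f : ι → EuclideanSpace ℝ (Fin K)) :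
    gInner Γ (∑ i ∈ s, f i) a = ∑ i ∈ s, gInner Γ (f i) a := by
  simp [gInner, sum_inner]

lemma gInner_smul_right' {K : ℕ} (Γ : Matrix (Fin K) (Fin K) ℝ)
    (a b : EuclideanSpace ℝ (Fin K)) (c : ℝ) :
    gInner Γ a (c • b) = c * gInner Γ a b := by
  simp [gInner, inner_smul_right]

lemma gInner_smul_left' {K : ℕ} (Γ : Matrix (Fin K) (Fin K) ℝ)
    (a b : EuclideanSpace ℝ (Fin K)) (c : ℝ) :
    gInner Γ (c • a) b = c * gInner Γ a b := by
  simp [gInner, inner_smul_left]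

lemma gInner_sub_right' {K : ℕ} (Γ : Matrix (Fin K) (Fin K) ℝ)
    (a b c : EuclideanSpace ℝ (Fin K)) :
    gInner Γ a (b - c) = gInner Γ a b - gInner Γ a c := by
  simp [gInner, inner_sub_right]

lemma gInner_pos' {K : ℕ} {Γ : Matrix (Fin K) (Fin K) ℝ} (hΓ : Γ.PosDef) :
    (Matrix.toEuclideanLin Γ⁻¹).IsPositive :=
  Matrix.isPositive_toEuclideanLin_iff.2 hΓ.inv.posSemidef

lemma gInner_comm' {K : ℕ} {Γ : Matrix (Fin K) (Fin K) ℝ} (hΓ : Γ.PosDef)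
    (a b : EuclideanSpace ℝ (Fin K)) : gInner Γ a b = gInner Γ b a := by
  have := (gInner_pos' hΓ).isSymmetric a b
  unfold gInner
  rw [this, real_inner_comm]

lemma gInner_nonneg' {K : ℕ} {Γ : Matrix (Fin K) (Fin K) ℝ} (hΓ : Γ.PosDef)
    (a : EuclideanSpace ℝ (Fin K)) : 0 ≤ gInner Γ a a :=
  (gInner_pos' hΓ).inner_nonneg_left a

lemma rhs_sub_mean {X : Type*} [NormedAddCommGroup X] [InnerProductSpace ℝ X]
    {K J : ℕ} (hJ : 0 < J) (A : X →L[ℝ] EuclideanSpace ℝ (Fin K))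
    (Γ : Matrix (Fin K) (Fin K) ℝ) (y : EuclideanSpace ℝ (Fin K)) (v : Fin J → X) (j : Fin J) :
    enkfRHS A Γ y v j - ensMean (enkfRHS A Γ y v) =
      -((J : ℝ)⁻¹ • ∑ k, gInner Γ (A (v k - ensMean v)) (A (v j - ensMean v)) •
        (v k - ensMean v)) := by
  have hJ' : (J : ℝ) ≠ 0 := by positivity
  have h1 : ensMean (enkfRHS A Γ y v) = (J : ℝ)⁻¹ • ∑ k,
      gInner Γ (A (v k - ensMean v)) (y - A (ensMean v)) • (v k - ensMean v) := by
    conv_lhs => unfold ensMean enkfRHS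
    rw [← Finset.smul_sum]
    congr 1
    rw [Finset.sum_comm, Finset.smul_sum]
    refine Finset.sum_congr rfl fun k _ => ?_
    rw [← Finset.sum_smul, smul_smul, ← gInner_sum_right', ← gInner_smul_right']
    congr 2
    simp only [Finset.sum_sub_distrib, smul_sub, Finset.sum_const, Finset.card_univ,
      Fintype.card_fin, ensMean, map_smul, map_sum]
    rw [← Nat.cast_smul_eq_nsmul ℝ, smul_smul, inv_mul_cancel₀ hJ', one_smul]
  rw [h1, enkfRHS, ← smul_sub, ← smul_neg, ← Finset.sum_sub_distrib, ← Finset.sum_neg_distrib]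
  congr 1
  refine Finset.sum_congr rfl fun k _ => ?_
  rw [← sub_smul, ← neg_smul, ← gInner_sub_right']
  congr 1
  rw [← neg_one_mul, ← gInner_smul_right']
  congr 1
  simp

/-- combination of deviations -/
def combP {X : Type*} [NormedAddCommGroup X] [InnerProductSpace ℝ X] {K J : ℕ}
    (A : X →L[ℝ] EuclideanSpace ℝ (Fin K)) (w : EuclideanSpace ℝ (Fin J)) (v : Fin J → X) :
    EuclideanSpace ℝ (Fin K) := ∑ j, w j • A (v j - ensMean v)

lemma matE_apply' {X : Type*} [NormedAddCommGroup X] [InnerProductSpace ℝ X] {K J : ℕ}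
    (A : X →L[ℝ] EuclideanSpace ℝ (Fin K)) (Γ : Matrix (Fin K) (Fin K) ℝ)
    (w : EuclideanSpace ℝ (Fin J)) (v : Fin J → X) (k : Fin J) :
    (Matrix.toEuclideanLin (matE A Γ v) w) k = gInner Γ (A (v k - ensMean v)) (combP A w v) := by
  simp [combP, gInner_sum_right', gInner_smul_right', Matrix.toLpLin_apply, Matrix.mulVec,
    dotProduct, matE, mul_comm]

lemma matE_inner {X : Type*} [NormedAddCommGroup X] [InnerProductSpace ℝ X] {K J : ℕ}
    (A : X →L[ℝ] EuclideanSpace ℝ (Fin K)) (Γ : Matrix (Fin K) (Fin K) ℝ)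
    (w z : EuclideanSpace ℝ (Fin J)) (v : Fin J → X) :
    ⟪z, Matrix.toEuclideanLin (matE A Γ v) w⟫ = gInner Γ (combP A z v) (combP A w v) := by
  rw [PiLp.inner_apply]
  simp only [matE_apply']
  conv_rhs => rw [combP, gInner_sum_left']
  refine Finset.sum_congr rfl fun k _ => ?_
  simp [gInner_smul_left', mul_comm]

lemma comb_deriv {X : Type*} [NormedAddCommGroup X] [InnerProductSpace ℝ X]
    {K J : ℕ} (hJ : 0 < J) (A : X →L[ℝ] EuclideanSpace ℝ (Fin K))
    (Γ : Matrix (Fin K) (Fin K) ℝ) (y : EuclideanSpace ℝ (Fin K)) (u : ℝ → Fin J → X)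
    (hu : IsEnKFSolution A Γ y u) (w : EuclideanSpace ℝ (Fin J)) (t : ℝ) (ht : 0 ≤ t) :
    HasDerivWithinAt (fun s => combP A w (u s))
      (-((J : ℝ)⁻¹ • ∑ k, gInner Γ (A (u t k - ensMean (u t))) (combP A w (u t)) •
        A (u t k - ensMean (u t)))) (Set.Ici 0) t := by
  have hm : HasDerivWithinAt (fun s => ensMean (u s)) (ensMean (enkfRHS A Γ y (u t)))
      (Set.Ici 0) t := by
    unfold ensMean
    exact (HasDerivWithinAt.fun_sum fun j _ => hu j t ht).const_smul _
  have h2 : HasDerivWithinAt (fun s => combP A w (u s))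
      (∑ j, w j • A (enkfRHS A Γ y (u t) j - ensMean (enkfRHS A Γ y (u t)))) (Set.Ici 0) t := by
    unfold combP
    refine HasDerivWithinAt.fun_sum fun j _ => ?_
    exact (A.hasFDerivAt.comp_hasDerivWithinAt t ((hu j t ht).sub hm)).const_smul (w j)
  convert h2 using 1
  simp only [rhs_sub_mean hJ, map_neg, map_smul, map_sum, smul_neg, Finset.sum_neg_distrib,
    Finset.smul_sum, combP, gInner_sum_right', gInner_smul_right', Finset.sum_smul, smul_smul]
  rw [Finset.sum_comm]
  congr 1
  refine Finset.sum_congr rfl fun k _ => Finset.sum_congr rfl fun j _ => ?_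
  congr 1
  ring

lemma q_deriv {X : Type*} [NormedAddCommGroup X] [InnerProductSpace ℝ X]
    {K J : ℕ} (hJ : 0 < J) (A : X →L[ℝ] EuclideanSpace ℝ (Fin K))
    (Γ : Matrix (Fin K) (Fin K) ℝ) (hΓ : Γ.PosDef) (y : EuclideanSpace ℝ (Fin K))
    (u : ℝ → Fin J → X)
    (hu : IsEnKFSolution A Γ y u) (w : EuclideanSpace ℝ (Fin J)) (t : ℝ) (ht : 0 ≤ t) :
    HasDerivWithinAt (fun s => gInner Γ (combP A w (u s)) (combP A w (u s)))
      (-(2 / J * ‖Matrix.toEuclideanLin (matE A Γ (u t)) w‖ ^ 2)) (Set.Ici 0) t := by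
  have h := comb_deriv hJ A Γ y u hu w t ht
  have h2 := ((LinearMap.toContinuousLinearMap
    (Matrix.toEuclideanLin Γ⁻¹)).hasFDerivAt.comp_hasDerivWithinAt t h).inner ℝ h
  refine HasDerivWithinAt.congr_deriv h2 ?_
  symm
  rw [EuclideanSpace.norm_sq_eq]
  simp only [matE_apply', Real.norm_eq_abs, sq_abs]
  change _ = gInner Γ _ _ + gInner Γ _ _
  rw [gInner_comm' hΓ (-((J : ℝ)⁻¹ • _))]
  rw [← neg_smul, gInner_smul_right', gInner_sum_right']
  simp only [gInner_smul_right']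
  simp only [gInner_comm' hΓ (combP A w (u t)), ← pow_two]
  ring

lemma riccati (q : ℝ → ℝ) (q' : ℝ → ℝ) (c : ℝ) (hc : 0 < c) (hq : ∀ t, 0 ≤ t → 0 ≤ q t)
    (hd : ∀ t, 0 ≤ t → HasDerivWithinAt q (q' t) (Set.Ici 0) t)
    (hq' : ∀ t, 0 ≤ t → c * q t ^ 2 ≤ - q' t) (t : ℝ) (ht : 0 < t) : q t ≤ 1 / (c * t) := by
  have hcont : ContinuousOn q (Set.Ici 0) := fun s hs => (hd s hs).continuousWithinAt
  have hda : ∀ s, 0 < s → HasDerivAt q (q' s) s := fun s hs =>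
    (hd s hs.le).hasDerivAt (Ici_mem_nhds hs)
  have hanti : AntitoneOn q (Set.Ici 0) := by
    refine antitoneOn_of_hasDerivWithinAt_nonpos (convex_Ici 0) hcont (f' := q') ?_ ?_
    · intro s hs
      rw [interior_Ici] at hs
      exact (hda s hs).hasDerivWithinAt
    · intro s hs
      rw [interior_Ici] at hs
      have := hq' s (le_of_lt hs)
      have : 0 ≤ c * q s ^ 2 := by positivity
      linarith
  rcases (hq t ht.le).eq_or_lt with h0 | hpos
  · rw [← h0]; positivity
  have hp : ∀ s ∈ Set.Icc 0 t, 0 < q s := fun s hs =>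
    hpos.trans_le (hanti hs.1 ht.le hs.2)
  have hmono : MonotoneOn (fun s => (q s)⁻¹ - c * s) (Set.Icc 0 t) := by
    refine monotoneOn_of_hasDerivWithinAt_nonneg (convex_Icc 0 t)
      (f' := fun s => -q' s / q s ^ 2 - c * 1) ?_ ?_ ?_
    · refine ContinuousOn.sub (ContinuousOn.inv₀ (hcont.mono Set.Icc_subset_Ici_self) ?_) ?_
      · intro s hs; exact (hp s hs).ne'
      · fun_prop
    · intro s hs
      rw [interior_Icc] at hs
      exact (((hda s hs.1).fun_inv (hp s ⟨hs.1.le, hs.2.le⟩).ne').sub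
        ((hasDerivAt_id s).const_mul c)).hasDerivWithinAt
    · intro s hs
      rw [interior_Icc] at hs
      have h1 := hp s ⟨hs.1.le, hs.2.le⟩
      have := hq' s hs.1.le
      rw [mul_one, sub_nonneg, le_div_iff₀ (by positivity)]
      exact this
  have := hmono (Set.left_mem_Icc.2 ht.le) (Set.right_mem_Icc.2 ht.le) ht.le
  have h0 : 0 < (q 0)⁻¹ := inv_pos.2 (hp 0 (Set.left_mem_Icc.2 ht.le))
  simp only [mul_zero, sub_zero] at this
  have h3 : c * t ≤ (q t)⁻¹ := by linarith
  rw [one_div]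
  exact (le_inv_comm₀ (by positivity) hpos).1 h3

lemma q_bound {X : Type*} [NormedAddCommGroup X] [InnerProductSpace ℝ X]
    {K J : ℕ} (hJ : 0 < J) (A : X →L[ℝ] EuclideanSpace ℝ (Fin K))
    (Γ : Matrix (Fin K) (Fin K) ℝ) (hΓ : Γ.PosDef) (y : EuclideanSpace ℝ (Fin K))
    (u : ℝ → Fin J → X)
    (hu : IsEnKFSolution A Γ y u) (w : EuclideanSpace ℝ (Fin J)) (t : ℝ) (ht : 0 < t) :
    gInner Γ (combP A w (u t)) (combP A w (u t)) ≤ J / (2 * t) * ‖w‖ ^ 2 := by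
  have hJ' : (0 : ℝ) < J := by positivity
  by_cases hw : w = 0
  · subst hw; simp [combP, gInner]
  have hw' : 0 < ‖w‖ := norm_pos_iff.2 hw
  have := riccati (fun s => gInner Γ (combP A w (u s)) (combP A w (u s))) _
    (2 / J / ‖w‖ ^ 2) (by positivity) (fun s _ => gInner_nonneg' hΓ _)
    (fun s hs => q_deriv hJ A Γ hΓ y u hu w s hs) ?_ t ht
  · refine this.trans_eq ?_
    field_simp
  · intro s _
    rw [neg_neg, ← matE_inner]
    have h1 := abs_real_inner_le_norm w (Matrix.toEuclideanLin (matE A Γ (u s)) w)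
    have h2 : ⟪w, Matrix.toEuclideanLin (matE A Γ (u s)) w⟫ ^ 2 ≤
        (‖w‖ * ‖Matrix.toEuclideanLin (matE A Γ (u s)) w‖) ^ 2 := by
      rw [← sq_abs]; gcongr
    calc _ ≤ 2 / J / ‖w‖ ^ 2 * (‖w‖ * ‖Matrix.toEuclideanLin (matE A Γ (u s)) w‖) ^ 2 := by
          gcongr
      _ = _ := by field_simp

lemma norm_bound {X : Type*} [NormedAddCommGroup X] [InnerProductSpace ℝ X]
    {K J : ℕ} (hJ : 0 < J) (A : X →L[ℝ] EuclideanSpace ℝ (Fin K))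
    (Γ : Matrix (Fin K) (Fin K) ℝ) (hΓ : Γ.PosDef) (y : EuclideanSpace ℝ (Fin K))
    (u : ℝ → Fin J → X)
    (hu : IsEnKFSolution A Γ y u) (w : EuclideanSpace ℝ (Fin J)) (t : ℝ) (ht : 0 < t) :
    ‖Matrix.toEuclideanLin (matE A Γ (u t)) w‖ ≤ J / (2 * t) * ‖w‖ := by
  have hJ' : (0 : ℝ) < J := by positivity
  have hq := q_bound hJ A Γ hΓ y u hu
  set c : ℝ := J / (2 * t) with hcdef
  have hc : 0 < c := by positivity
  set T := Matrix.toEuclideanLin (matE A Γ (u t)) with hT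
  set v := T w with hv
  have h1 : 0 ≤ ⟪w - c⁻¹ • v, T (w - c⁻¹ • v)⟫ := by
    rw [hT, matE_inner]; exact gInner_nonneg' hΓ _
  have hsym : ⟪w, T v⟫ = ‖v‖ ^ 2 := by
    rw [hT, matE_inner, gInner_comm' hΓ, ← matE_inner, ← hT, ← hv, real_inner_self_eq_norm_sq]
  have hw := hq w t ht
  have hvv := hq v t ht
  rw [← matE_inner] at hw hvv
  rw [← hT] at hw hvv
  rw [← hcdef] at hw hvv
  simp only [map_sub, map_smul, inner_sub_left, inner_sub_right, inner_smul_left,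
    inner_smul_right, hsym, ← hv, real_inner_self_eq_norm_sq, conj_trivial] at h1
  rw [← hv] at hw
  have h4 : c⁻¹ * (c⁻¹ * ⟪v, T v⟫) ≤ c⁻¹ * (c⁻¹ * (c * ‖v‖ ^ 2)) := by gcongr
  have h5 : c⁻¹ * (c⁻¹ * (c * ‖v‖ ^ 2)) = c⁻¹ * ‖v‖ ^ 2 := by field_simp
  have h6 : c⁻¹ * ‖v‖ ^ 2 ≤ c * ‖w‖ ^ 2 := by linarith
  have h7 : ‖v‖ ^ 2 ≤ (c * ‖w‖) ^ 2 := by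
    rw [inv_mul_le_iff₀ hc] at h6
    linarith
  exact le_of_sq_le_sq h7 (by positivity)

theorem enkf_ensemble_collapse
    {X : Type*} [NormedAddCommGroup X] [InnerProductSpace ℝ X]
    {K J : ℕ} (hJ : 0 < J)
    (A : X →L[ℝ] EuclideanSpace ℝ (Fin K))
    (Γ : Matrix (Fin K) (Fin K) ℝ) (hΓ : Γ.PosDef)
    (udag : X) (u : ℝ → Fin J → X)
    (hu : IsEnKFSolution A Γ (A udag) u) :
    Filter.Tendsto (fun t => matE A Γ (u t)) Filter.atTop (nhds 0) ∧
    (∀ t > (0 : ℝ), ∀ μ : ℝ,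
      Module.End.HasEigenvalue (Matrix.toEuclideanLin (matE A Γ (u t))) μ →
        μ ≤ (J : ℝ) / (2 * t)) ∧
    ∀ t > (0 : ℝ),
      ‖LinearMap.toContinuousLinearMap (Matrix.toEuclideanLin (matE A Γ (u t)))‖ ≤
        (J : ℝ) / (2 * t) := by
  have hJ' : (0 : ℝ) < J := by positivity
  have hb := norm_bound hJ A Γ hΓ (A udag) u hu
  refine ⟨?_, ?_, ?_⟩
  · have hlim : Filter.Tendsto (fun t : ℝ => (J : ℝ) / (2 * t)) Filter.atTop (nhds 0) :=
      Filter.Tendsto.const_div_atTop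
        (Filter.Tendsto.const_mul_atTop (by norm_num) Filter.tendsto_id) _
    refine tendsto_pi_nhds.2 fun i => tendsto_pi_nhds.2 fun j => ?_
    refine squeeze_zero_norm' ?_ hlim
    filter_upwards [Filter.eventually_gt_atTop 0] with t ht
    have h1 := hb (EuclideanSpace.single j 1) t ht
    have h2 := PiLp.norm_apply_le (Matrix.toEuclideanLin (matE A Γ (u t))
      (EuclideanSpace.single j 1)) i
    have h3 : (Matrix.toEuclideanLin (matE A Γ (u t)) (EuclideanSpace.single j 1)) i
        = matE A Γ (u t) i j := by
      simp [Matrix.toLpLin_apply]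
    rw [h3] at h2
    simp only [EuclideanSpace.norm_single, norm_one, mul_one] at h1
    exact h2.trans h1
  · intro t ht μ hμ
    obtain ⟨w, hw⟩ := hμ.exists_hasEigenvector
    have h1 := hb w t ht
    rw [hw.apply_eq_smul, norm_smul] at h1
    have h2 : 0 < ‖w‖ := norm_pos_iff.2 hw.2
    exact (le_abs_self μ).trans (le_of_mul_le_mul_right h1 h2)
  · intro t ht
    exact ContinuousLinearMap.opNorm_le_bound _ (by positivity) fun w => hb w t ht

end
end

section
/- Residual decomposition and convergence in observation space: assume y = A u† with A one-to-one, let Y^∥ be the linear span of {A e^{(j)}(0)}_{j=1}^J and Y^⊥ its orthogonal complement in Y with respect to ⟨·,·⟩_Γ, and assume the initial ensemble is chosen so that dim Y^∥ = min{J−1, K} (maximal dimension). Then for each j, A r^{(j)}(t) decomposes uniquely as A r^{(j)}_∥(t) + A r^{(j)}_⊥(t) with A r^{(j)}_∥(t) ∈ Y^∥ and A r^{(j)}_⊥(t) ∈ Y^⊥; moreover A r^{(j)}_∥(t) → 0 as t → ∞ for every j, and A r^{(j)}_⊥(t) = A r^{(j)}_⊥(0) = A r^{(1)}_⊥(0)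 for all j and all t ≥ 0. -/
open scoped BigOperators
open RealInnerProductSpace Matrix

noncomputable section

section
variable {V : Type*} [NormedAddCommGroup V] [InnerProductSpace ℝ V] {ι : Type*} [Fintype ι]

def cov (c : ℝ) (a : ι → V) : V →ₗ[ℝ] V :=
  c • ∑ k, (innerₗ V (a k)).smulRight (a k)

lemma cov_apply (c : ℝ) (a : ι → V) (x : V) :
    cov c a x = c • ∑ k, ⟪a k, x⟫ • a k := by
  simp [cov]

lemma cov_inner (c : ℝ) (a : ι → V) (x y : V) :
    ⟪cov c a x, y⟫ = c * ∑ k, ⟪a k, x⟫ * ⟪a k, y⟫ := by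
  simp [cov_apply, inner_smul_left, sum_inner]

lemma cov_symm (c : ℝ) (a : ι → V) (x y : V) :
    ⟪cov c a x, y⟫ = ⟪x, cov c a y⟫ := by
  rw [real_inner_comm (cov c a y) x, cov_inner, cov_inner]; simp [mul_comm]

lemma cov_nonneg {c : ℝ} (hc : 0 < c) (a : ι → V) (x : V) : 0 ≤ ⟪cov c a x, x⟫ := by
  rw [cov_inner]
  exact mul_nonneg hc.le (Finset.sum_nonneg fun k _ => mul_self_nonneg _)

lemma cov_eq_zero {c : ℝ} (hc : 0 < c) (a : ι → V) (x : V) (h : cov c a x = 0) (k : ι) :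
    ⟪a k, x⟫ = 0 := by
  have h1 : ⟪cov c a x, x⟫ = 0 := by rw [h]; simp
  rw [cov_inner] at h1
  have h2 := (mul_eq_zero.1 h1).resolve_left hc.ne'
  rw [Finset.sum_eq_zero_iff_of_nonneg (fun k _ => mul_self_nonneg _)] at h2
  simpa using h2 k (Finset.mem_univ k)

lemma cov_deriv {c : ℝ} {a : ι → ℝ → V} {s : Set ℝ} {t : ℝ}
    (ha : ∀ k, HasDerivWithinAt (a k) (-(cov c (fun k => a k t) (a k t))) s t)
    {x : ℝ → V} {x' : V} (hx : HasDerivWithinAt x x' s t) :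
    HasDerivWithinAt (fun τ => cov c (fun k => a k τ) (x τ))
      (cov c (fun k => a k t) (x' - (2:ℝ) • cov c (fun k => a k t) (x t))) s t := by
  have h := (HasDerivWithinAt.fun_sum (u := Finset.univ)
    (fun k _ => ((ha k).inner ℝ hx).smul (ha k))).const_smul c
  simp only [cov_apply c (fun k => a k _) (x _)]
  refine (h.congr_deriv ?_)
  rw [map_sub, map_smul]
  simp only [inner_neg_left, cov_symm, smul_neg, Finset.sum_add_distrib, add_smul, neg_smul,
    Finset.sum_neg_distrib, smul_add, ← map_smul, ← map_sum, two_smul]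
  rw [← cov_apply c (fun k => a k t) (x t), ← cov_apply c (fun k => a k t) (cov c _ (x t)),
    ← cov_apply c (fun k => a k t) x', map_add]
  module

lemma dissip {c : ℝ} (hc : 0 < c) {a : ι → ℝ → V} {z : ℝ → V}
    (hz : ∀ t ∈ Set.Ici (0:ℝ), HasDerivWithinAt z
      (-((2:ℝ) • cov c (fun k => a k t) (z t))) (Set.Ici 0) t) (h0 : z 0 = 0)
    {t : ℝ} (ht : 0 ≤ t) : z t = 0 := by
  have hd := fun t ht => (hz t ht).inner ℝ (hz t ht)
  have hanti : AntitoneOn (fun t => ⟪z t, z t⟫) (Set.Ici (0:ℝ)) := by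
    refine antitoneOn_of_hasDerivWithinAt_nonpos (convex_Ici 0)
      (fun t ht => (hd t ht).continuousWithinAt) (fun t ht => (hd t ?_).mono interior_subset) ?_
    · exact interior_subset ht
    · intro t ht
      have := cov_nonneg hc (fun k => a k t) (z t)
      simp only [inner_neg_left, inner_neg_right, inner_smul_left, inner_smul_right]
      rw [← cov_symm]
      simp
      linarith
  have h1 := hanti (Set.mem_Ici.2 le_rfl) (Set.mem_Ici.2 ht) ht
  simp only [h0, inner_zero_left] at h1
  rw [real_inner_self_eq_norm_sq] at h1
  exact norm_eq_zero.1 (pow_eq_zero_iff (two_ne_zero)|>.1 (le_antisymm h1 (sq_nonneg _)))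

lemma const_of {f : ℝ → ℝ} (hz : ∀ t ∈ Set.Ici (0:ℝ), HasDerivWithinAt f 0 (Set.Ici 0) t) 
    {t : ℝ} (ht : 0 ≤ t) : f t = f 0 := by
  apply le_antisymm
  · exact antitoneOn_of_hasDerivWithinAt_nonpos (f' := fun _ => 0) (convex_Ici 0)
      (fun t ht => (hz t ht).continuousWithinAt) (fun t ht => (hz t (interior_subset ht)).mono interior_subset)
      (fun _ _ => le_rfl) (Set.mem_Ici.2 le_rfl) (Set.mem_Ici.2 ht) ht
  · exact monotoneOn_of_hasDerivWithinAt_nonneg (f' := fun _ => 0) (convex_Ici 0)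
      (fun t ht => (hz t ht).continuousWithinAt) (fun t ht => (hz t (interior_subset ht)).mono interior_subset)
      (fun _ _ => le_rfl) (Set.mem_Ici.2 le_rfl) (Set.mem_Ici.2 ht) ht

lemma cov_M {c : ℝ} (hc : 0 < c) {a : ι → ℝ → V}
    (ha : ∀ k, ∀ t ∈ Set.Ici (0:ℝ),
      HasDerivWithinAt (a k) (-(cov c (fun k => a k t) (a k t))) (Set.Ici 0) t)
    (w : V) {t : ℝ} (ht : 0 ≤ t) :
    cov c (fun k => a k t) (w + t • (2:ℝ) • cov c (fun k => a k 0) w)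
      = cov c (fun k => a k 0) w := by
  set C0 := cov c (fun k => a k 0) with hC0
  have h := dissip hc (a := a)
    (z := fun t => cov c (fun k => a k t) (w + t • (2:ℝ) • C0 w) - C0 w) ?_ (by simp [hC0]) ht
  · exact sub_eq_zero.1 h
  · intro t ht
    have hx : HasDerivWithinAt (fun t : ℝ => w + t • (2:ℝ) • C0 w) ((2:ℝ) • C0 w) (Set.Ici 0) t := by
      simpa using ((hasDerivWithinAt_id t (Set.Ici (0:ℝ))).smul_const ((2:ℝ) • C0 w)).const_add w
    refine ((cov_deriv (fun k => ha k t ht) hx).sub_const (C0 w)).congr_deriv ?_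
    simp only [map_sub, map_smul]
    module

lemma perp_of {c : ℝ} (hc : 0 < c) {a : ι → ℝ → V}
    (ha : ∀ k, ∀ t ∈ Set.Ici (0:ℝ),
      HasDerivWithinAt (a k) (-(cov c (fun k => a k t) (a k t))) (Set.Ici 0) t)
    (w : V) (hw : ∀ k, ⟪a k 0, w⟫ = 0) {t : ℝ} (ht : 0 ≤ t) :
    cov c (fun k => a k t) w = 0 := by
  have h0 : cov c (fun k => a k 0) w = 0 := by simp [cov_apply, hw]
  have := cov_M hc ha w ht
  simpa [h0] using this

lemma energy {c : ℝ} (hc : 0 < c) {a : ι → ℝ → V}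
    (ha : ∀ k, ∀ t ∈ Set.Ici (0:ℝ),
      HasDerivWithinAt (a k) (-(cov c (fun k => a k t) (a k t))) (Set.Ici 0) t)
    {v : ℝ → V} (hv : ∀ t ∈ Set.Ici (0:ℝ),
      HasDerivWithinAt v (-(cov c (fun k => a k t) (v t))) (Set.Ici 0) t)
    {t : ℝ} (ht : 0 ≤ t) :
    ⟪v t, v t⟫ + t * (2 * (c * ∑ k, ⟪a k 0, v t⟫ * ⟪a k 0, v t⟫)) = ⟪v 0, v 0⟫ := by
  have h := const_of (f := fun t => 
    ⟪v t, v t⟫ + t * (2 * (c * ∑ k, ⟪a k 0, v t⟫ * ⟪a k 0, v t⟫))) ?_ ht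
  · simpa using h
  · intro t ht
    have h2 := fun k : ι => (hasDerivWithinAt_const t (Set.Ici (0:ℝ)) (a k 0)).inner ℝ (hv t ht)
    have h3 := HasDerivWithinAt.fun_sum (u := Finset.univ) (fun k _ => (h2 k).mul (h2 k))
    have h4 := ((hv t ht).inner ℝ (hv t ht)).add
      ((hasDerivWithinAt_id t (Set.Ici (0:ℝ))).mul ((h3.const_mul c).const_mul 2))
    refine h4.congr_deriv ?_
    have e1 := cov_M hc ha (v t) ht
    have e2 : ⟪v t, cov c (fun k => a k t) (v t + t • (2:ℝ) • cov c (fun k => a k 0) (v t))⟫ = 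
      ⟪v t, cov c (fun k => a k 0) (v t)⟫ := by rw [e1]
    rw [← cov_symm, ← cov_symm, inner_add_right, inner_smul_right, inner_smul_right,
      ← cov_symm c (fun k => a k 0), real_inner_comm, cov_inner c (fun k => a k 0),
      cov_inner c (fun k => a k 0) _ (v t)] at e2
    have e3 := real_inner_comm (v t) (cov c (fun k => a k t) (v t))
    simp only [inner_neg_right, inner_neg_left, inner_zero_left, add_zero, id, one_mul,
      mul_neg, neg_mul, Finset.sum_add_distrib, Finset.sum_neg_distrib, Pi.mul_apply] 
    have e4 : ∑ k, ⟪a k 0, cov c (fun k => a k t) (v t)⟫ * ⟪a k 0, v t⟫ = 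
      ∑ k, ⟪a k 0, v t⟫ * ⟪a k 0, cov c (fun k => a k t) (v t)⟫ := by simp [mul_comm]
    rw [e4] at e2 ⊢
    linarith

end

lemma tendsto_of {V : Type*} [NormedAddCommGroup V] [InnerProductSpace ℝ V] {ι : Type*} [Fintype ι]
    [FiniteDimensional ℝ V] {a : ι → V} {v : ℝ → V}
    (hv : ∀ t, 0 ≤ t → v t ∈ Submodule.span ℝ (Set.range a)) {D : ℝ}
    (hD : ∀ t, 0 ≤ t → t * ∑ k, ⟪a k, v t⟫ * ⟪a k, v t⟫ ≤ D) :
    Filter.Tendsto v Filter.atTop (nhds 0) := by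
  have hcoord : ∀ k, Filter.Tendsto (fun t => ⟪a k, v t⟫) Filter.atTop (nhds 0) := by
    intro k
    have h1 : Filter.Tendsto (fun t => ⟪a k, v t⟫ ^ 2) Filter.atTop (nhds 0) := by
      have hb : Filter.Tendsto (fun t : ℝ => D / t) Filter.atTop (nhds 0) :=
        Filter.Tendsto.const_div_atTop Filter.tendsto_id D
      refine tendsto_of_tendsto_of_tendsto_of_le_of_le' tendsto_const_nhds hb
        (Filter.Eventually.of_forall fun t => sq_nonneg _) ?_
      filter_upwards [Filter.eventually_gt_atTop 0] with t ht
      rw [le_div_iff₀ ht, mul_comm, sq]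
      refine le_trans (mul_le_mul_of_nonneg_left ?_ ht.le) (hD t ht.le)
      exact Finset.single_le_sum (f := fun k => ⟪a k, v t⟫ * ⟪a k, v t⟫)
        (fun i _ => mul_self_nonneg _) (Finset.mem_univ k)
    have h2 := h1.sqrt
    simp only [Real.sqrt_sq_eq_abs, Real.sqrt_zero] at h2
    exact (tendsto_zero_iff_abs_tendsto_zero _).2 h2
  let T : Submodule.span ℝ (Set.range a) →ₗ[ℝ] (ι → ℝ) :=
    (LinearMap.pi fun k => innerₗ V (a k)) ∘ₗ (Submodule.span ℝ (Set.range a)).subtype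
  have hker : LinearMap.ker T = ⊥ := by
    rw [LinearMap.ker_eq_bot']
    intro m hm
    have hk : ∀ k, ⟪a k, (m : V)⟫ = 0 := fun k => by simpa [T] using congrFun hm k
    have h3 : ∀ x ∈ Submodule.span ℝ (Set.range a), ⟪x, (m : V)⟫ = 0 := by
      intro x hx
      induction hx using Submodule.span_induction with
      | mem x h => obtain ⟨k, rfl⟩ := h; exact hk k
      | zero => simp
      | add x y _ _ h1 h2 => rw [inner_add_left, h1, h2, add_zero]
      | smul c x _ h => rw [inner_smul_left, h, mul_zero]
    exact Subtype.ext (inner_self_eq_zero.1 (h3 m m.2))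
  obtain ⟨C, -, hC⟩ := T.exists_antilipschitzWith hker
  have hT : Filter.Tendsto (fun t => (C : ℝ) * ‖(fun k => ⟪a k, v t⟫ : ι → ℝ)‖)
      Filter.atTop (nhds 0) := by
    have := (tendsto_pi_nhds.2 hcoord).norm.const_mul (C : ℝ)
    have e : (C : ℝ) * ‖(fun _ => 0 : ι → ℝ)‖ = 0 := by
      rw [show (fun _ => 0 : ι → ℝ) = 0 from rfl]; simp
    rwa [e] at this
  refine squeeze_zero_norm' ?_ hT
  filter_upwards [Filter.eventually_ge_atTop 0] with t ht
  have := hC.le_mul_dist (⟨v t, hv t ht⟩ : Submodule.span ℝ (Set.range a)) 0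
  rw [map_zero, dist_zero_right, dist_zero_right] at this
  exact this

lemma main_abs {V : Type*} [NormedAddCommGroup V] [InnerProductSpace ℝ V] {ι : Type*} [Fintype ι]
    [FiniteDimensional ℝ V] {c : ℝ} (hc : 0 < c) {a : ι → ℝ → V}
    (ha : ∀ k, ∀ t ∈ Set.Ici (0:ℝ),
      HasDerivWithinAt (a k) (-(cov c (fun k => a k t) (a k t))) (Set.Ici 0) t)
    {r : ι → ℝ → V} (hr : ∀ j, ∀ t ∈ Set.Ici (0:ℝ),
      HasDerivWithinAt (r j) (-(cov c (fun k => a k t) (r j t))) (Set.Ici 0) t)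
    (j0 : ι) (hd : ∀ j, r j 0 - r j0 0 ∈ Submodule.span ℝ (Set.range fun k => a k 0)) :
    ∃ q ∈ (Submodule.span ℝ (Set.range fun k => a k 0))ᗮ,
      ∀ j, (∀ t, 0 ≤ t → r j t - q ∈ Submodule.span ℝ (Set.range fun k => a k 0)) ∧
        Filter.Tendsto (fun t => r j t - q) Filter.atTop (nhds 0) := by
  set P := Submodule.span ℝ (Set.range fun k => a k 0) with hP
  have hcov : ∀ w ∈ Pᗮ, ∀ t, 0 ≤ t → cov c (fun k => a k t) w = 0 := by
    intro w hw t ht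
    refine perp_of hc ha w (fun k => ?_) ht
    exact (Submodule.mem_orthogonal P w).1 hw _ (Submodule.subset_span ⟨k, rfl⟩)
  have hq := P.sub_starProjection_mem_orthogonal (r j0 0)
  set q := r j0 0 - P.starProjection (r j0 0) with hqd
  have hmem : ∀ j t, 0 ≤ t → r j t - q ∈ P := by
    intro j t ht
    rw [← Submodule.orthogonal_orthogonal P, Submodule.mem_orthogonal]
    intro w hw
    have h1 : ⟪w, r j t⟫ = ⟪w, r j 0⟫ := by
      refine const_of (f := fun t => ⟪w, r j t⟫) (fun t ht => ?_) ht
      refine ((hasDerivWithinAt_const t (Set.Ici (0:ℝ)) w).inner ℝ (hr j t ht)).congr_deriv ?_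
      rw [inner_neg_right, ← cov_symm, hcov w hw t ht]
      simp
    have h2 : r j 0 - q ∈ P := by
      have : r j 0 - q = (r j 0 - r j0 0) + P.starProjection (r j0 0) := by rw [hqd]; abel
      rw [this]
      exact P.add_mem (hd j) (P.starProjection_apply_mem _)
    rw [inner_sub_right, h1, ← inner_sub_right]
    exact (Submodule.mem_orthogonal' P w).1 hw _ h2
  refine ⟨q, hq, fun j => ⟨hmem j, ?_⟩⟩
  have hv : ∀ t ∈ Set.Ici (0:ℝ), HasDerivWithinAt (fun t => r j t - q)
      (-(cov c (fun k => a k t) (r j t - q))) (Set.Ici 0) t := by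
    intro t ht
    refine ((hr j t ht).sub_const q).congr_deriv ?_
    rw [map_sub, hcov q hq t ht, sub_zero]
  refine tendsto_of (a := fun k => a k 0) (D := ⟪r j 0 - q, r j 0 - q⟫ / (2 * c)) (hmem j) ?_
  intro t ht
  have h := energy hc ha hv ht
  have h0 : 0 ≤ ⟪r j t - q, r j t - q⟫ := real_inner_self_nonneg
  rw [le_div_iff₀ (by positivity)]
  linarith

section
open scoped MatrixOrder ComplexOrder

lemma exists_sqrt {K : ℕ} {Γ : Matrix (Fin K) (Fin K) ℝ} (hΓ : Γ.PosDef) :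
    ∃ S : EuclideanSpace ℝ (Fin K) ≃L[ℝ] EuclideanSpace ℝ (Fin K),
      ∀ a b, gInner Γ a b = ⟪S a, S b⟫ := by
  have hi : Γ⁻¹.PosDef := hΓ.inv
  obtain ⟨B, hB⟩ := CStarAlgebra.nonneg_iff_eq_star_mul_self.mp hi.posSemidef.nonneg
  have key : ∀ a b, gInner Γ a b = ⟪Matrix.toEuclideanLin B a, Matrix.toEuclideanLin B b⟫ := by
    intro a b
    have h1 : Matrix.toEuclideanLin Γ⁻¹ a
        = Matrix.toEuclideanLin Bᴴ (Matrix.toEuclideanLin B a) := by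
      rw [hB]
      simp [Matrix.toEuclideanLin_apply, Matrix.mulVec_mulVec, Matrix.star_eq_conjTranspose]
    rw [gInner, h1, Matrix.toEuclideanLin_conjTranspose_eq_adjoint, LinearMap.adjoint_inner_left]
  have hinj : Function.Injective (Matrix.toEuclideanLin B) := by
    rw [← LinearMap.ker_eq_bot, LinearMap.ker_eq_bot']
    intro m hm
    have h2 := key m m
    rw [hm, inner_zero_left] at h2
    by_contra hne
    have hne' : m.ofLp ≠ 0 := fun h => hne (by ext i; simpa using congrFun h i)
    have h3 := hi.dotProduct_mulVec_pos hne'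
    have h4 : gInner Γ m m = star m.ofLp ⬝ᵥ (Γ⁻¹ *ᵥ m.ofLp) := by
      rw [gInner, real_inner_comm, EuclideanSpace.inner_eq_star_dotProduct, dotProduct_comm]
      simp [Matrix.toEuclideanLin_apply]
    linarith
  refine ⟨(LinearEquiv.ofInjectiveEndo _ hinj).toContinuousLinearEquiv, fun a b => ?_⟩
  rw [key]; rfl
end

theorem enkf_residual_decomposition_observation_space
    {X : Type*} [NormedAddCommGroup X] [InnerProductSpace ℝ X]
    {K J : ℕ} (hJ : 0 < J)
    (A : X →L[ℝ] EuclideanSpace ℝ (Fin K)) (hA : Function.Injective A)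
    (Γ : Matrix (Fin K) (Fin K) ℝ) (hΓ : Γ.PosDef)
    (udag : X) (u : ℝ → Fin J → X)
    (hu : IsEnKFSolution A Γ (A udag) u)
    (Ypar : Submodule ℝ (EuclideanSpace ℝ (Fin K)))
    (hYpar : Ypar = Submodule.span ℝ (Set.range fun j => A (u 0 j - ensMean (u 0))))
    (hmax : Module.finrank ℝ Ypar = min (J - 1) K) :
    ∃ p : Fin J → ℝ → EuclideanSpace ℝ (Fin K),
      ∃ q : EuclideanSpace ℝ (Fin K),
        q ∈ gOrth Γ Ypar ∧
        (∀ j, ∀ t ∈ Set.Ici (0 : ℝ),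
          p j t ∈ Ypar ∧ A (u t j - udag) = p j t + q) ∧
        (∀ j, ∀ t ∈ Set.Ici (0 : ℝ), ∀ p' q' : EuclideanSpace ℝ (Fin K),
          p' ∈ Ypar → q' ∈ gOrth Γ Ypar → A (u t j - udag) = p' + q' →
            p' = p j t ∧ q' = q) ∧
        ∀ j, Filter.Tendsto (p j) Filter.atTop (nhds 0) := by
  obtain ⟨S, hS⟩ := exists_sqrt hΓ
  have hJ' : (0:ℝ) < (J:ℝ)⁻¹ := by positivity
  have hJ0 : (J:ℝ) ≠ 0 := by positivity
  let L : X →L[ℝ] EuclideanSpace ℝ (Fin K) := S.toContinuousLinearMap.comp A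
  have hL : ∀ x, L x = S (A x) := fun _ => rfl
  let r : Fin J → ℝ → EuclideanSpace ℝ (Fin K) := fun j t => L (u t j - udag)
  let a : Fin J → ℝ → EuclideanSpace ℝ (Fin K) := fun j t => L (u t j - ensMean (u t))
  have hrhs : ∀ j t, L (enkfRHS A Γ (A udag) (u t) j)
      = -(cov (J:ℝ)⁻¹ (fun k => a k t) (r j t)) := by
    intro j t
    rw [enkfRHS, cov_apply, _root_.map_smul, map_sum, ← smul_neg, ← Finset.sum_neg_distrib]
    congr 1
    refine Finset.sum_congr rfl fun k _ => ?_
    rw [_root_.map_smul, hS, ← neg_smul, ← inner_neg_right, ← map_sub A, ← hL, ← hL, ← map_neg L,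
      neg_sub]
  have hr : ∀ j, ∀ t ∈ Set.Ici (0:ℝ),
      HasDerivWithinAt (r j) (-(cov (J:ℝ)⁻¹ (fun k => a k t) (r j t))) (Set.Ici 0) t := by
    intro j t ht
    rw [← hrhs]
    exact L.hasFDerivAt.comp_hasDerivWithinAt t ((hu j t ht).sub_const udag)
  have har : ∀ k t, a k t = r k t - (J:ℝ)⁻¹ • ∑ j, r j t := by
    intro k t
    simp only [a, r, ensMean, map_sub, _root_.map_smul, map_sum, Finset.sum_sub_distrib,
      Finset.sum_const, Finset.card_univ, Fintype.card_fin, smul_sub]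
    rw [← Nat.cast_smul_eq_nsmul ℝ, inv_smul_smul₀ hJ0]
    abel
  have ha : ∀ k, ∀ t ∈ Set.Ici (0:ℝ),
      HasDerivWithinAt (a k) (-(cov (J:ℝ)⁻¹ (fun k => a k t) (a k t))) (Set.Ici 0) t := by
    intro k t ht
    have e : a k = fun t => r k t - (J:ℝ)⁻¹ • ∑ j, r j t := funext (har k)
    have h1 := (hr k t ht).sub ((HasDerivWithinAt.fun_sum (u := Finset.univ)
      (fun j _ => hr j t ht)).const_smul (J:ℝ)⁻¹)
    have e2 : -(cov (J:ℝ)⁻¹ (fun k => a k t) (a k t))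
        = -(cov (J:ℝ)⁻¹ (fun k => a k t) (r k t))
          - (J:ℝ)⁻¹ • ∑ j, -(cov (J:ℝ)⁻¹ (fun k => a k t) (r j t)) := by
      rw [har k t, map_sub, _root_.map_smul, map_sum, Finset.sum_neg_distrib, smul_neg]
      abel
    rw [e2, e]
    exact h1
  have hspan : ∀ x, x ∈ Ypar ↔ S x ∈ Submodule.span ℝ (Set.range fun k => a k 0) := by
    intro x
    have e : (Set.range fun k => a k 0)
        = S.toLinearEquiv.toLinearMap '' (Set.range fun j => A (u 0 j - ensMean (u 0))) := by
      rw [← Set.range_comp]; rfl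
    rw [e, Submodule.span_image, ← hYpar]
    constructor
    · intro h; exact ⟨x, h, rfl⟩
    · rintro ⟨z, hz, hzx⟩
      have : z = x := S.injective hzx
      exact this ▸ hz
  have horth : ∀ x, x ∈ gOrth Γ Ypar ↔
      S x ∈ (Submodule.span ℝ (Set.range fun k => a k 0))ᗮ := by
    intro x
    rw [Submodule.mem_orthogonal]
    constructor
    · intro h z hz
      have h1 := h (S.symm z) ((hspan _).2 (by simpa using hz))
      rw [hS] at h1
      simpa using h1
    · intro h v hv
      rw [hS]
      exact h _ ((hspan v).1 hv)
  obtain ⟨q, hq, H⟩ := main_abs hJ' ha hr ⟨0, hJ⟩ (by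
    intro j
    have e : r j 0 - r ⟨0, hJ⟩ 0 = a j 0 - a ⟨0, hJ⟩ 0 := by rw [har, har]; abel
    rw [e]
    exact Submodule.sub_mem _ (Submodule.subset_span ⟨j, rfl⟩) (Submodule.subset_span ⟨_, rfl⟩))
  have hqo : S.symm q ∈ gOrth Γ Ypar := (horth _).2 (by simpa using hq)
  have hpm : ∀ j t, 0 ≤ t → A (u t j - udag) - S.symm q ∈ Ypar := by
    intro j t ht
    rw [hspan, map_sub, ← hL]
    rw [S.apply_symm_apply]
    exact (H j).1 t ht
  refine ⟨fun j t => A (u t j - udag) - S.symm q, S.symm q, hqo, ?_, ?_, ?_⟩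
  · intro j t ht
    exact ⟨hpm j t ht, by simp⟩
  · intro j t ht p' q' hp' hq' e
    have h1 : q' - S.symm q ∈ gOrth Γ Ypar := Submodule.sub_mem _ hq' hqo
    have h2 : q' - S.symm q ∈ Ypar := by
      have : q' - S.symm q = (A (u t j - udag) - S.symm q) - p' := by rw [e]; abel
      rw [this]
      exact Submodule.sub_mem _ (hpm j t ht) hp'
    have h3 := h1 _ h2
    rw [hS, inner_self_eq_zero] at h3
    have h4 : q' = S.symm q := sub_eq_zero.1 (S.injective (by rw [h3, map_zero]))
    refine ⟨?_, h4⟩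
    show p' = A (u t j - udag) - S.symm q
    rw [e, h4]; abel
  · intro j
    have h := (S.symm.continuous.tendsto 0).comp (H j).2
    rw [map_zero] at h
    refine h.congr fun t => ?_
    simp [r, hL]

end
end

section
/- Residual convergence in state space for boundedly invertible forward operator: assume y = A u†, that A is boundedly invertible, and that the initial ensemble is chosen so that X_0 := span{e^{(1)}(0),…,e^{(J)}(0)} has maximal dimension J−1. Write X = X_0 ⊕ X_1, where X_1 is the orthogonal complement of X_0 with respect to the inner product ⟨v,w⟩_* := ⟨A v, A w⟩_Γ. Then each residual decomposes uniquely as r^{(j)}(t) = r^{(j)}_∥(t) + r^{(j)}_⊥(t) with r^{(j)}_∥(t) ∈ X_0 and r^{(j)}_⊥(t) ∈ X_1; moreover r^{(j)}_∥(t) → 0 as t → ∞ and r^{(j)}_⊥(t) = r^{(j)}_⊥(0) = r^{(1)}_⊥(0) for all j and t ≥ 0. -/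
open scoped BigOperators
open RealInnerProductSpace Matrix

noncomputable section

theorem anti_aux (D : Set ℝ) (hD : Convex ℝ D) (hD0 : D ⊆ Set.Ici 0) (f f' : ℝ → ℝ)
    (h : ∀ t ∈ Set.Ici (0:ℝ), HasDerivWithinAt f (f' t) (Set.Ici 0) t)
    (h0 : ∀ t ∈ D, f' t ≤ 0) : AntitoneOn f D := by
  apply antitoneOn_of_hasDerivWithinAt_nonpos hD (f' := f')
  · intro t ht
    exact ((h t (hD0 ht)).continuousWithinAt).mono hD0
  · intro t ht
    exact (h t (hD0 (interior_subset ht))).mono (interior_subset.trans hD0)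
  · intro t ht
    exact h0 t (interior_subset ht)

theorem riccati_aux (f f' : ℝ → ℝ) (a : ℝ) (ha : 0 < a) (hf : ∀ t, 0 ≤ f t)
    (h : ∀ t ∈ Set.Ici (0:ℝ), HasDerivWithinAt f (f' t) (Set.Ici 0) t)
    (h0 : ∀ t ∈ Set.Ici (0:ℝ), f' t ≤ - a * f t ^ 2) :
    Filter.Tendsto f Filter.atTop (nhds 0) := by
  have hanti : AntitoneOn f (Set.Ici 0) := by
    refine anti_aux _ (convex_Ici 0) subset_rfl f f' h ?_
    intro t ht
    have := h0 t ht
    nlinarith [sq_nonneg (f t)]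
  have key : ∀ t, 0 < t → f t ^ 2 ≤ f 0 / a / t := by
    intro t ht
    have hg := anti_aux (Set.Icc 0 t) (convex_Icc 0 t) Set.Icc_subset_Ici_self
      (fun s => f s + a * f t ^ 2 * s) (fun s => f' s + a * f t ^ 2 * 1)
      (fun s hs => (h s hs).add ((hasDerivWithinAt_id s _).const_mul _)) (by
        intro s hs
        have h1 := h0 s hs.1
        have h2 := hanti hs.1 (le_of_lt ht : (0:ℝ) ≤ t) hs.2
        have h3 := pow_le_pow_left₀ (hf t) h2 2
        have h4 := mul_le_mul_of_nonneg_left h3 ha.le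
        linarith)
    have := hg (Set.left_mem_Icc.2 ht.le) (Set.right_mem_Icc.2 ht.le) ht.le
    rw [div_div, le_div_iff₀ (by positivity)]
    nlinarith [hf t]
  have hsq : Filter.Tendsto (fun t => f t ^ 2) Filter.atTop (nhds 0) := by
    refine squeeze_zero' (Filter.Eventually.of_forall fun t => sq_nonneg _) ?_
      (Filter.Tendsto.div_atTop (tendsto_const_nhds (x := f 0 / a)) Filter.tendsto_id)
    filter_upwards [Filter.eventually_gt_atTop 0] with t ht using key t ht
  have := (Real.continuous_sqrt.tendsto 0).comp hsq
  simp only [Real.sqrt_zero] at this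
  refine this.congr fun t => ?_
  simp [Real.sqrt_sq (hf t)]

theorem core_aux {H : Type*} [NormedAddCommGroup H] [InnerProductSpace ℝ H]
    [FiniteDimensional ℝ H] {J : ℕ} (hJ : 0 < J) (v : ℝ → Fin J → H) (m : ℝ → H)
    (hv : ∀ j, ∀ t ∈ Set.Ici (0:ℝ), HasDerivWithinAt (fun s => v s j)
      (-((J:ℝ)⁻¹ • ∑ k, ⟪v t k, v t j⟫ • v t k)) (Set.Ici 0) t)
    (hm : ∀ t ∈ Set.Ici (0:ℝ), HasDerivWithinAt m
      (-((J:ℝ)⁻¹ • ∑ k, ⟪v t k, m t⟫ • v t k)) (Set.Ici 0) t) :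
    (∀ j, Filter.Tendsto (fun t => v t j) Filter.atTop (nhds 0)) ∧
    (∀ j, ∀ t ∈ Set.Ici (0:ℝ), v t j ∈ Submodule.span ℝ (Set.range (v 0))) ∧
    ∃ c : Fin J → ℝ, ∃ q ∈ (Submodule.span ℝ (Set.range (v 0)))ᗮ,
      ∀ t ∈ Set.Ici (0:ℝ), m t = ∑ k, c k • v t k + q := by
  have hJ' : (0:ℝ) < J := by exact_mod_cast hJ
  have hspan : ∀ j, ∀ t ∈ Set.Ici (0:ℝ), v t j ∈ Submodule.span ℝ (Set.range (v 0)) := by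
    intro j t ht
    rw [← Submodule.orthogonal_orthogonal (Submodule.span ℝ (Set.range (v 0)))]
    rw [Submodule.mem_orthogonal]
    intro w hw
    have hanti := anti_aux (Set.Ici 0) (convex_Ici 0) subset_rfl
      (fun s => ∑ j, ⟪w, v s j⟫ ^ 2)
      (fun s => - (2 * (J:ℝ)⁻¹ * ‖∑ k, ⟪w, v s k⟫ • v s k‖ ^ 2)) (by
        intro s hs
        have := HasDerivWithinAt.fun_sum (u := Finset.univ) fun j _ =>
          (((innerSL ℝ w).hasFDerivAt.comp_hasDerivWithinAt s (hv j s hs)).pow 2)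
        refine this.congr_deriv ?_
        simp only [innerSL_apply_apply, inner_neg_right, inner_smul_right, inner_sum,
          ← real_inner_self_eq_norm_sq, sum_inner, inner_smul_left]
        simp only [Finset.mul_sum, ← Finset.sum_neg_distrib]
        refine Finset.sum_congr rfl fun i _ => Finset.sum_congr rfl fun k _ => ?_
        rw [real_inner_comm (v s i) (v s k)]
        simp
        ring) (by
        intro s hs
        have : 0 ≤ 2 * (J:ℝ)⁻¹ * ‖∑ k, ⟪w, v s k⟫ • v s k‖ ^ 2 := by positivity
        simpa using this)
    have h1 := hanti (Set.mem_Ici.2 le_rfl) ht ht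
    have h2 : ∀ k, ⟪w, v 0 k⟫ = 0 := fun k => by
      rw [real_inner_comm]
      exact (Submodule.mem_orthogonal _ _).1 hw _ (Submodule.subset_span ⟨k, rfl⟩)
    simp only [h2] at h1
    have h3 := Finset.single_le_sum (f := fun j => ⟪w, v t j⟫ ^ 2)
      (fun i _ => sq_nonneg _) (Finset.mem_univ j)
    have h4 : ⟪w, v t j⟫ ^ 2 ≤ 0 := by
      refine h3.trans (h1.trans ?_)
      simp
    exact pow_eq_zero_iff (two_ne_zero) |>.1 (le_antisymm h4 (sq_nonneg _))
  refine ⟨?_, hspan, ?_⟩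
  · have hφ := riccati_aux (fun s => ∑ j, ‖v s j‖ ^ 2)
      (fun s => - (2 * (J:ℝ)⁻¹ * ∑ j, ∑ k, ⟪v s k, v s j⟫ ^ 2)) (2 * (J:ℝ)⁻¹ * (J:ℝ)⁻¹)
      (by positivity) (fun t => by positivity) (by
        intro s hs
        have := HasDerivWithinAt.fun_sum (u := Finset.univ) fun j _ => (hv j s hs).norm_sq
        refine this.congr_deriv ?_
        simp only [inner_neg_right, inner_smul_right, inner_sum]
        simp only [Finset.mul_sum, ← Finset.sum_neg_distrib]
        refine Finset.sum_congr rfl fun i _ => Finset.sum_congr rfl fun k _ => ?_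
        rw [real_inner_comm (v s i) (v s k)]
        ring) (by
        intro s hs
        have h1 : (∑ j, ‖v s j‖ ^ 2) ^ 2 ≤ J * ∑ j, (‖v s j‖ ^ 2) ^ 2 := by
          simpa using sq_sum_le_card_mul_sum_sq (s := Finset.univ) (f := fun j => ‖v s j‖ ^ 2)
        have h2 : ∑ j, (‖v s j‖ ^ 2) ^ 2 ≤ ∑ j, ∑ k, ⟪v s k, v s j⟫ ^ 2 := by
          refine Finset.sum_le_sum fun j _ => ?_
          rw [← real_inner_self_eq_norm_sq]
          exact Finset.single_le_sum (f := fun k => ⟪v s k, v s j⟫ ^ 2)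
            (fun i _ => sq_nonneg _) (Finset.mem_univ j)
        have h3 : (J:ℝ)⁻¹ * (∑ j, ‖v s j‖ ^ 2) ^ 2 ≤ ∑ j, ∑ k, ⟪v s k, v s j⟫ ^ 2 := by
          rw [inv_mul_le_iff₀ hJ']
          exact h1.trans (mul_le_mul_of_nonneg_left h2 hJ'.le)
        have h4 := mul_le_mul_of_nonneg_left h3 (by positivity : 0 ≤ 2 * (J:ℝ)⁻¹)
        linarith)
    intro j
    rw [tendsto_zero_iff_norm_tendsto_zero]
    have := (Real.continuous_sqrt.tendsto 0).comp hφ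
    simp only [Real.sqrt_zero] at this
    refine squeeze_zero (fun t => norm_nonneg _) (fun t => ?_) this
    apply Real.le_sqrt_of_sq_le
    exact Finset.single_le_sum (f := fun j => ‖v t j‖ ^ 2)
      (fun i _ => sq_nonneg _) (Finset.mem_univ j)
  · obtain ⟨p, hp, q, hq, hpq⟩ :=
      (Submodule.span ℝ (Set.range (v 0))).exists_add_mem_mem_orthogonal (m 0)
    obtain ⟨c, hc⟩ := (Submodule.mem_span_range_iff_exists_fun ℝ).1 hp
    refine ⟨c, q, hq, ?_⟩
    have hq' : ∀ s ∈ Set.Ici (0:ℝ), ∀ k, ⟪v s k, q⟫ = 0 := fun s hs k =>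
      (Submodule.mem_orthogonal _ _).1 hq _ (hspan k s hs)
    intro t ht
    have hanti := anti_aux (Set.Ici 0) (convex_Ici 0) subset_rfl
      (fun s => ‖m s - ∑ k, c k • v s k - q‖ ^ 2)
      (fun s => - (2 * (J:ℝ)⁻¹ * ∑ k, ⟪v s k, m s - ∑ k, c k • v s k - q⟫ ^ 2)) (by
        intro s hs
        have h1 := HasDerivWithinAt.fun_sum (u := Finset.univ) fun j _ =>
          (hv j s hs).const_smul (c j)
        have h2 := (((hm s hs).sub h1).sub_const q).norm_sq
        refine h2.congr_deriv ?_
        have h3 : -((J:ℝ)⁻¹ • ∑ k, ⟪v s k, m s⟫ • v s k) -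
            ∑ j, c j • -((J:ℝ)⁻¹ • ∑ k, ⟪v s k, v s j⟫ • v s k) =
            -((J:ℝ)⁻¹ • ∑ k, ⟪v s k, m s - ∑ k, c k • v s k - q⟫ • v s k) := by
          simp only [inner_sub_right, hq' s hs, sub_zero, inner_sum, inner_smul_right, sub_smul,
            Finset.sum_sub_distrib, smul_sub, Finset.sum_smul, smul_neg, Finset.sum_neg_distrib]
          simp only [Finset.smul_sum, smul_smul]
          rw [neg_sub_neg, neg_sub]
          congr 1
          rw [Finset.sum_comm]
          refine Finset.sum_congr rfl fun i _ => Finset.sum_congr rfl fun k _ => ?_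
          congr 1
          ring
        rw [h3, inner_neg_right, inner_smul_right, inner_sum]
        simp only [Finset.mul_sum, ← Finset.sum_neg_distrib]
        refine Finset.sum_congr rfl fun i _ => ?_
        rw [inner_smul_right, real_inner_comm (v s i)]
        simp
        ring) (by
        intro s hs
        have : 0 ≤ 2 * (J:ℝ)⁻¹ * ∑ k, ⟪v s k, m s - ∑ k, c k • v s k - q⟫ ^ 2 := by positivity
        simpa using this)
    have h1 := hanti (Set.mem_Ici.2 le_rfl) ht ht
    simp only [hc, hpq] at h1
    have h2 : ‖m t - ∑ k, c k • v t k - q‖ ^ 2 = 0 := by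
      refine le_antisymm (h1.trans ?_) (sq_nonneg _)
      simp
    have h3 := norm_eq_zero.1 (pow_eq_zero_iff two_ne_zero |>.1 h2)
    rw [sub_sub, sub_eq_zero] at h3
    exact h3

theorem exists_L_aux {X : Type*} [NormedAddCommGroup X] [InnerProductSpace ℝ X]
    {K : ℕ}
    (A : X →L[ℝ] EuclideanSpace ℝ (Fin K))
    (B : EuclideanSpace ℝ (Fin K) →L[ℝ] X)
    (hBA : ∀ x, B (A x) = x) (hAB : ∀ w, A (B w) = w)
    (Γ : Matrix (Fin K) (Fin K) ℝ) (hΓ : Γ.PosDef) :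
    ∃ L : X ≃L[ℝ] EuclideanSpace ℝ (Fin K), ∀ v w, gInner Γ (A v) (A w) = ⟪L v, L w⟫ := by
  have hΓ' := hΓ.inv
  obtain ⟨S, hS⟩ : ∃ S : Matrix (Fin K) (Fin K) ℝ, Γ⁻¹ = Sᴴ * S := by
    open scoped MatrixOrder in
    obtain ⟨S, hS⟩ := CStarAlgebra.nonneg_iff_eq_star_mul_self.1 hΓ'.posSemidef.nonneg
    exact ⟨S, hS⟩
  have hin : ∀ a b : EuclideanSpace ℝ (Fin K), gInner Γ a b =
      ⟪Matrix.toEuclideanLin S a, Matrix.toEuclideanLin S b⟫ := by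
    intro a b
    rw [gInner, hS, ← LinearMap.adjoint_inner_left, ← Matrix.toEuclideanLin_conjTranspose_eq_adjoint]
    congr 1
    simp [Matrix.toEuclideanLin, Matrix.toLin'_mul]
  have hdet : IsUnit S := by
    have h1 := hΓ'.isUnit
    rw [hS] at h1
    rw [Matrix.isUnit_iff_isUnit_det] at h1 ⊢
    rw [Matrix.det_mul] at h1
    exact isUnit_of_mul_isUnit_right h1
  have hinj : Function.Injective (Matrix.toEuclideanLin S) := by
    intro a b hab
    have := Matrix.mulVec_injective_iff_isUnit.2 hdet (a₁ := a.ofLp) (a₂ := b.ofLp)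
      (congrArg WithLp.ofLp hab)
    ext i
    exact congrFun this i
  refine ⟨(ContinuousLinearEquiv.equivOfInverse A B hBA hAB).trans
    (LinearEquiv.ofInjectiveEndo _ hinj).toContinuousLinearEquiv, fun v w => ?_⟩
  rw [hin]
  rfl

theorem enkf_residual_decomposition_state_space
    {X : Type*} [NormedAddCommGroup X] [InnerProductSpace ℝ X]
    {K J : ℕ} (hJ : 0 < J)
    (A : X →L[ℝ] EuclideanSpace ℝ (Fin K))
    (B : EuclideanSpace ℝ (Fin K) →L[ℝ] X)
    (hBA : ∀ x, B (A x) = x) (hAB : ∀ w, A (B w) = w)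
    (Γ : Matrix (Fin K) (Fin K) ℝ) (hΓ : Γ.PosDef)
    (udag : X) (u : ℝ → Fin J → X)
    (hu : IsEnKFSolution A Γ (A udag) u)
    (X0 : Submodule ℝ X)
    (hX0 : X0 = Submodule.span ℝ (Set.range fun j => u 0 j - ensMean (u 0)))
    (hmax : Module.finrank ℝ X0 = J - 1) :
    IsCompl X0 (gOrthX A Γ X0) ∧
    ∃ p : Fin J → ℝ → X, ∃ q : X,
      q ∈ gOrthX A Γ X0 ∧
      (∀ j, ∀ t ∈ Set.Ici (0 : ℝ),
        p j t ∈ X0 ∧ u t j - udag = p j t + q) ∧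
      (∀ j, ∀ t ∈ Set.Ici (0 : ℝ), ∀ p' q' : X,
        p' ∈ X0 → q' ∈ gOrthX A Γ X0 → u t j - udag = p' + q' →
          p' = p j t ∧ q' = q) ∧
      ∀ j, Filter.Tendsto (p j) Filter.atTop (nhds 0) := by
  obtain ⟨L, hL⟩ := exists_L_aux A B hBA hAB Γ hΓ
  have hJ' : (J:ℝ) ≠ 0 := by exact_mod_cast hJ.ne'
  -- the covariance-type operator
  let G : ℝ → X →ₗ[ℝ] X := fun t => -((J:ℝ)⁻¹ • ∑ k,
    ((innerₛₗ ℝ (L (u t k - ensMean (u t)))).comp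
      (L.toLinearEquiv : X →ₗ[ℝ] EuclideanSpace ℝ (Fin K))).smulRight (u t k - ensMean (u t)))
  have hG : ∀ t x, G t x = -((J:ℝ)⁻¹ • ∑ k,
      ⟪L (u t k - ensMean (u t)), L x⟫ • (u t k - ensMean (u t))) := by
    intro t x
    simp [G, inner_sub_left]
  have hLG : ∀ t x, L (G t x) = -((J:ℝ)⁻¹ • ∑ k,
      ⟪L (u t k - ensMean (u t)), L x⟫ • L (u t k - ensMean (u t))) := by
    intro t x
    rw [hG]
    simp only [map_neg, map_smul, map_sum]
  have hu' : ∀ j, ∀ t ∈ Set.Ici (0:ℝ),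
      HasDerivWithinAt (fun s => u s j) (G t (u t j - udag)) (Set.Ici 0) t := by
    intro j t ht
    refine (hu j t ht).congr_deriv ?_
    rw [hG, enkfRHS, ← smul_neg, ← Finset.sum_neg_distrib]
    congr 1
    refine Finset.sum_congr rfl fun k _ => ?_
    rw [← map_sub, hL, ← neg_smul, ← inner_neg_right, ← map_neg, neg_sub]
  have hmean : ∀ t ∈ Set.Ici (0:ℝ), HasDerivWithinAt (fun s => ensMean (u s) - udag)
      (G t (ensMean (u t) - udag)) (Set.Ici 0) t := by
    intro t ht
    have h1 := ((HasDerivWithinAt.fun_sum (u := Finset.univ) fun j _ =>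
      hu' j t ht).const_smul (J:ℝ)⁻¹).sub_const udag
    refine h1.congr_deriv ?_
    rw [← map_sum, ← map_smul]
    congr 1
    simp only [Finset.sum_sub_distrib, smul_sub, ensMean, Finset.sum_const, Finset.card_univ,
      Fintype.card_fin, ← Nat.cast_smul_eq_nsmul ℝ, smul_smul, inv_mul_cancel₀ hJ', one_smul]
  have hdev : ∀ j, ∀ t ∈ Set.Ici (0:ℝ), HasDerivWithinAt (fun s => u s j - ensMean (u s))
      (G t (u t j - ensMean (u t))) (Set.Ici 0) t := by
    intro j t ht
    have h1 := ((hu' j t ht).sub_const udag).sub (hmean t ht)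
    rw [← map_sub, sub_sub_sub_cancel_right] at h1
    refine h1.congr_of_mem (fun s _ => ?_) ht
    simp
  obtain ⟨htend, hspan, c, q, hq, hdec⟩ := core_aux hJ
    (fun t j => L (u t j - ensMean (u t))) (fun t => L (ensMean (u t) - udag))
    (fun j t ht => (L.toContinuousLinearMap.hasFDerivAt.comp_hasDerivWithinAt t (hdev j t ht)).congr_deriv
      (hLG _ _))
    (fun t ht => (L.toContinuousLinearMap.hasFDerivAt.comp_hasDerivWithinAt t (hmean t ht)).congr_deriv
      (hLG _ _))
  have hmap : Submodule.span ℝ (Set.range fun j => L (u 0 j - ensMean (u 0))) =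
      X0.map (L.toLinearEquiv : X →ₗ[ℝ] EuclideanSpace ℝ (Fin K)) := by
    rw [hX0, Submodule.map_span, ← Set.range_comp]
    rfl
  rw [hmap] at hq
  simp only [hmap] at hspan
  have hmem : ∀ x, L x ∈ X0.map (L.toLinearEquiv : X →ₗ[ℝ] EuclideanSpace ℝ (Fin K)) → x ∈ X0 := by
    rintro x ⟨z, hz, hzx⟩
    have : z = x := L.injective hzx
    exact this ▸ hz
  have horth : ∀ z, z ∈ (X0.map (L.toLinearEquiv : X →ₗ[ℝ] EuclideanSpace ℝ (Fin K)))ᗮ →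
      L.symm z ∈ gOrthX A Γ X0 := by
    intro z hz w hw
    rw [hL, L.apply_symm_apply]
    exact (Submodule.mem_orthogonal _ _).1 hz _ ⟨w, hw, rfl⟩
  have hdisj : ∀ x, x ∈ X0 → x ∈ gOrthX A Γ X0 → x = 0 := by
    intro x hx hx'
    have h1 : gInner Γ (A x) (A x) = 0 := hx' x hx
    rw [hL] at h1
    have h2 := inner_self_eq_zero.1 h1
    exact L.injective (by rw [h2, map_zero])
  have hev : ∀ j, ∀ t ∈ Set.Ici (0:ℝ), u t j - ensMean (u t) ∈ X0 :=
    fun j t ht => hmem _ (hspan j t ht)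
  have hp : ∀ j, ∀ t ∈ Set.Ici (0:ℝ), u t j - ensMean (u t) +
      ∑ k, c k • (u t k - ensMean (u t)) ∈ X0 := fun j t ht =>
    add_mem (hev j t ht) (sum_mem fun k _ => Submodule.smul_mem _ _ (hev k t ht))
  have heq : ∀ j, ∀ t ∈ Set.Ici (0:ℝ), u t j - udag = u t j - ensMean (u t) +
      ∑ k, c k • (u t k - ensMean (u t)) + L.symm q := by
    intro j t ht
    have h1 := hdec t ht
    have h2 : ensMean (u t) - udag = ∑ k, c k • (u t k - ensMean (u t)) + L.symm q := by
      apply L.injective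
      rw [h1]
      simp only [map_add, map_sum, map_smul, L.apply_symm_apply]
    rw [add_assoc, ← h2]
    abel
  have hev0 : ∀ j, Filter.Tendsto (fun t => u t j - ensMean (u t)) Filter.atTop (nhds 0) := by
    intro j
    have h1 := (L.symm.continuous.tendsto 0).comp (htend j)
    rw [map_zero] at h1
    exact h1.congr fun t => L.symm_apply_apply _
  refine ⟨⟨?_, ?_⟩, fun j t => u t j - ensMean (u t) + ∑ k, c k • (u t k - ensMean (u t)),
    L.symm q, horth q hq, fun j t ht => ⟨hp j t ht, heq j t ht⟩, ?_, ?_⟩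
  · rw [Submodule.disjoint_def]
    exact hdisj
  · rw [codisjoint_iff, Submodule.eq_top_iff']
    intro x
    obtain ⟨a, ha, b, hb, hab⟩ := (X0.map (L.toLinearEquiv : X →ₗ[ℝ]
      EuclideanSpace ℝ (Fin K))).exists_add_mem_mem_orthogonal (L x)
    refine Submodule.mem_sup.2 ⟨L.symm a, hmem _ (by rwa [L.apply_symm_apply]),
      L.symm b, horth b hb, ?_⟩
    rw [← map_add, ← hab, L.symm_apply_apply]
  · intro j t ht p' q' hp' hq' h
    rw [heq j t ht] at h
    have h1 : p' - (u t j - ensMean (u t) + ∑ k, c k • (u t k - ensMean (u t))) =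
        L.symm q - q' := by
      rw [sub_eq_sub_iff_add_eq_add, ← h, add_comm]
    have h2 := hdisj _ (sub_mem hp' (hp j t ht))
      (h1 ▸ sub_mem (horth q hq) hq')
    refine ⟨sub_eq_zero.1 h2, ?_⟩
    rw [h1] at h2
    exact (sub_eq_zero.1 h2).symm
  · intro j
    have h1 := (hev0 j).add (tendsto_finsetSum Finset.univ fun k _ => (hev0 k).const_smul (c k))
    simpa using h1

end
end

section
/- Monotone decay of the least-squares misfit along the EnKF flow: for any data y ∈ Y and any solution u = (u^{(1)},…,u^{(J)}) of the continuous-time EnKF flow, the map t ↦ Φ(u^{(j)}(t); y) = (1/2)‖y − A u^{(j)}(t)‖_Γ² is nonincreasing for each j, i.e. d/dt Φ(u^{(j)}(t); y) ≤ 0 for all t in the interval of existence. -/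
open scoped BigOperators
open RealInnerProductSpace Matrix

noncomputable section

theorem gInner_symm_aux {K : ℕ} (Γ : Matrix (Fin K) (Fin K) ℝ) (hΓ : Γ.PosDef)
    (a b : EuclideanSpace ℝ (Fin K)) : gInner Γ a b = gInner Γ b a := by
  have h : (Matrix.toEuclideanLin Γ⁻¹).IsSymmetric :=
    Matrix.isSymmetric_toEuclideanLin_iff.2 hΓ.isHermitian.inv
  unfold gInner
  rw [h a b, real_inner_comm]

theorem gInner_rhs_aux {X : Type*} [NormedAddCommGroup X] [InnerProductSpace ℝ X]
    {K J : ℕ} (A : X →L[ℝ] EuclideanSpace ℝ (Fin K)) (Γ : Matrix (Fin K) (Fin K) ℝ)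
    (y : EuclideanSpace ℝ (Fin K)) (v : Fin J → X) (j : Fin J) :
    gInner Γ (A (enkfRHS A Γ y v j)) (y - A (v j)) =
      (J : ℝ)⁻¹ * ∑ k, gInner Γ (A (v k - ensMean v)) (y - A (v j)) ^ 2 := by
  have h : ∀ c : Fin J → ℝ, ∀ w : Fin J → X, ∀ r,
      gInner Γ (A ((J : ℝ)⁻¹ • ∑ k, c k • w k)) r
        = (J : ℝ)⁻¹ * ∑ k, c k * gInner Γ (A (w k)) r := by
    intro c w r
    unfold gInner
    simp only [_root_.map_smul, map_sum, sum_inner, real_inner_smul_left]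
  unfold enkfRHS
  rw [h]
  simp only [pow_two]

theorem misfit_deriv_aux {X : Type*} [NormedAddCommGroup X] [InnerProductSpace ℝ X]
    {K J : ℕ} (A : X →L[ℝ] EuclideanSpace ℝ (Fin K))
    (Γ : Matrix (Fin K) (Fin K) ℝ) (hΓ : Γ.PosDef)
    (y : EuclideanSpace ℝ (Fin K)) (u : ℝ → Fin J → X)
    (hu : IsEnKFSolution A Γ y u) (j : Fin J) (t : ℝ) (ht : t ∈ Set.Ici (0 : ℝ)) :
    ∃ d : ℝ, d ≤ 0 ∧
        HasDerivWithinAt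
          (fun s => (1 / 2 : ℝ) * gInner Γ (y - A (u s j)) (y - A (u s j)))
          d (Set.Ici 0) t := by
  have h1 : HasDerivWithinAt (fun s => y - A (u s j)) (-(A (enkfRHS A Γ y (u t) j)))
      (Set.Ici 0) t :=
    (A.hasFDerivAt.comp_hasDerivWithinAt t (hu j t ht)).const_sub y
  have h2 : HasDerivWithinAt (fun s => Matrix.toEuclideanLin Γ⁻¹ (y - A (u s j)))
      (Matrix.toEuclideanLin Γ⁻¹ (-(A (enkfRHS A Γ y (u t) j)))) (Set.Ici 0) t :=
    (LinearMap.toContinuousLinearMap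
      (Matrix.toEuclideanLin Γ⁻¹)).hasFDerivAt.comp_hasDerivWithinAt t h1
  have h3 := (h2.inner ℝ h1).const_mul (1 / 2 : ℝ)
  rw [map_neg, inner_neg_left, inner_neg_right] at h3
  have hg : ∀ a b : EuclideanSpace ℝ (Fin K),
      ⟪Matrix.toEuclideanLin Γ⁻¹ a, b⟫ = gInner Γ a b := fun _ _ => rfl
  simp only [hg] at h3
  refine ⟨_, ?_, h3⟩
  have e := gInner_rhs_aux A Γ y (u t) j
  have e' := gInner_symm_aux Γ hΓ (y - A (u t j)) (A (enkfRHS A Γ y (u t) j))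
  have hn : 0 ≤ (J : ℝ)⁻¹ *
      ∑ k, gInner Γ (A (u t k - ensMean (u t))) (y - A (u t j)) ^ 2 :=
    mul_nonneg (inv_nonneg.2 (Nat.cast_nonneg J)) (Finset.sum_nonneg fun k _ => sq_nonneg _)
  rw [← e] at hn
  linarith

theorem enkf_misfit_monotone_decay
    {X : Type*} [NormedAddCommGroup X] [InnerProductSpace ℝ X]
    {K J : ℕ} (hJ : 0 < J)
    (A : X →L[ℝ] EuclideanSpace ℝ (Fin K))
    (Γ : Matrix (Fin K) (Fin K) ℝ) (hΓ : Γ.PosDef)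
    (y : EuclideanSpace ℝ (Fin K)) (u : ℝ → Fin J → X)
    (hu : IsEnKFSolution A Γ y u) :
    ∀ j : Fin J,
      AntitoneOn
        (fun t => (1 / 2 : ℝ) * gInner Γ (y - A (u t j)) (y - A (u t j)))
        (Set.Ici 0) ∧
      ∀ t ∈ Set.Ici (0 : ℝ), ∃ d : ℝ, d ≤ 0 ∧
        HasDerivWithinAt
          (fun s => (1 / 2 : ℝ) * gInner Γ (y - A (u s j)) (y - A (u s j)))
          d (Set.Ici 0) t := by
  intro j
  have key := misfit_deriv_aux A Γ hΓ y u hu j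
  refine ⟨?_, key⟩
  choose! d hd hd' using key
  refine antitoneOn_of_hasDerivWithinAt_nonpos (f' := d) (convex_Ici 0)
    (fun t ht => (hd' t ht).continuousWithinAt) ?_ ?_
  · intro t ht
    exact (hd' t (interior_subset ht)).mono interior_subset
  · intro t ht
    exact hd t (interior_subset ht)

end
end

section
/- Explicit spectral solution of the deviation Gram matrix: suppose E : [0,∞) → ℝ^{J×J} is symmetric positive semidefinite, satisfies dE/dt = −(2/J)E², and E(0) = X Λ(0) Xᵀ with X orthogonal and Λ(0) = diag(λ_0^{(1)},…,λ_0^{(J)}) diagonal with λ_0^{(j)} ≥ 0. Then E(t) = X Λ(t) Xᵀ for all t ≥ 0, where Λ(t) = diag(λ^{(1)}(t),…,λ^{(J)}(t)) with λ^{(j)}(t) = ((2/J)t + 1/λ_0^{(j)})^{-1} if λ_0^{(j)} ≠ 0 and λ^{(j)}(t) = 0 if λ_0^{(j)} = 0. -/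
open scoped BigOperators
open RealInnerProductSpace Matrix

noncomputable section

theorem gram_riccati_explicit_solution
    {J : ℕ} (hJ : 1 ≤ J)
    (E : ℝ → Matrix (Fin J) (Fin J) ℝ)
    (hpsd : ∀ t ∈ Set.Ici (0 : ℝ), (E t).PosSemidef)
    (hode : ∀ t ∈ Set.Ici (0 : ℝ), ∀ i j : Fin J,
      HasDerivWithinAt (fun s => E s i j)
        ((-(2 / (J : ℝ))) * (E t * E t) i j) (Set.Ici 0) t)
    (X : Matrix (Fin J) (Fin J) ℝ) (hX : X * Xᵀ = 1)
    (lam0 : Fin J → ℝ) (hlam0 : ∀ j, 0 ≤ lam0 j)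
    (hE0 : E 0 = X * Matrix.diagonal lam0 * Xᵀ) :
    ∀ t ∈ Set.Ici (0 : ℝ),
      E t = X * Matrix.diagonal (fun j =>
        if lam0 j = 0 then 0 else ((2 / (J : ℝ)) * t + (lam0 j)⁻¹)⁻¹) * Xᵀ := by
  have hX' : Xᵀ * X = 1 := mul_eq_one_comm.mp hX
  have hc : (0 : ℝ) ≤ 2 / (J : ℝ) := by positivity
  generalize 2 / (J : ℝ) = c at *
  set l : ℝ → Fin J → ℝ := fun t j => if lam0 j = 0 then 0 else (c * t + (lam0 j)⁻¹)⁻¹ with hl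
  set F : ℝ → Matrix (Fin J) (Fin J) ℝ := fun t => X * Matrix.diagonal (l t) * Xᵀ with hF
  have hl0 : l 0 = lam0 := by
    funext j
    by_cases h : lam0 j = 0 <;> simp [hl, h]
  have hlnn : ∀ t ∈ Set.Ici (0 : ℝ), ∀ j, 0 ≤ l t j := by
    intro t ht j
    have h1 : (0 : ℝ) ≤ t := ht
    have h2 := hlam0 j
    simp only [hl]
    split_ifs
    · exact le_rfl
    · positivity
  have hld : ∀ t ∈ Set.Ici (0 : ℝ), ∀ j, HasDerivAt (fun s => l s j) (-c * (l t j * l t j)) t := by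
    intro t ht j
    have h1 : (0 : ℝ) ≤ t := ht
    by_cases h : lam0 j = 0
    · simpa [hl, h] using hasDerivAt_const t (0 : ℝ)
    · have h2 : 0 < lam0 j := lt_of_le_of_ne (hlam0 j) (Ne.symm h)
      have h3 : c * t + (lam0 j)⁻¹ ≠ 0 := by positivity
      have h4 : HasDerivAt (fun s => c * s + (lam0 j)⁻¹) c t := by
        simpa using ((hasDerivAt_id t).const_mul c).add_const (lam0 j)⁻¹
      have h5 := h4.fun_inv h3
      simp only [hl, h, if_false]
      rw [div_eq_mul_inv, sq, mul_inv] at h5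
      exact h5
  have hFent : ∀ (d : Fin J → ℝ) i j, (X * Matrix.diagonal d * Xᵀ) i j = ∑ k, X i k * d k * X j k := by
    intro d i j
    rw [Matrix.mul_apply]
    simp only [Matrix.mul_diagonal, Matrix.transpose_apply]
  have hFF : ∀ t, F t * F t = X * Matrix.diagonal (fun k => l t k * l t k) * Xᵀ := by
    intro t
    rw [← Matrix.diagonal_mul_diagonal]
    calc F t * F t = X * Matrix.diagonal (l t) * (Xᵀ * X) * Matrix.diagonal (l t) * Xᵀ := by
          simp only [hF, Matrix.mul_assoc]
      _ = _ := by rw [hX']; simp only [Matrix.mul_assoc, Matrix.mul_one, Matrix.one_mul]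
  have hFd : ∀ t ∈ Set.Ici (0 : ℝ), ∀ i j,
      HasDerivWithinAt (fun s => F s i j) (-c * (F t * F t) i j) (Set.Ici 0) t := by
    intro t ht i j
    rw [hFF, hFent, Finset.mul_sum]
    simp only [hF, hFent]
    apply HasDerivWithinAt.fun_sum
    intro k _
    have := (((hld t ht k).const_mul (X i k)).mul_const (X j k)).hasDerivWithinAt (s := Set.Ici 0)
    convert this using 1
    ring
  have hFpsd : ∀ t ∈ Set.Ici (0 : ℝ), (F t).PosSemidef := by
    intro t ht
    have := (Matrix.PosSemidef.diagonal (hlnn t ht)).mul_mul_conjTranspose_same X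
    simpa [hF, Matrix.conjTranspose_eq_transpose_of_trivial] using this
  set φ : ℝ → ℝ := fun t => ∑ i, ∑ j, (E t i j - F t i j) ^ 2 with hφ
  set φ' : ℝ → ℝ := fun t => ∑ i, ∑ j,
    2 * (E t i j - F t i j) * (-c * (E t * E t) i j - -c * (F t * F t) i j) with hφ'
  have hφd : ∀ t ∈ Set.Ici (0 : ℝ), HasDerivWithinAt φ (φ' t) (Set.Ici 0) t := by
    intro t ht
    apply HasDerivWithinAt.fun_sum
    intro i _
    apply HasDerivWithinAt.fun_sum
    intro j _
    have := ((hode t ht i j).fun_sub (hFd t ht i j)).fun_pow 2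
    simpa using this
  have hφle : ∀ t ∈ Set.Ici (0 : ℝ), φ' t ≤ 0 := by
    intro t ht
    have hD : (E t - F t)ᴴ = E t - F t := ((hpsd t ht).1.sub (hFpsd t ht).1)
    have h1 := ((hpsd t ht).conjTranspose_mul_mul_same (E t - F t)).trace_nonneg
    have h2 := ((hFpsd t ht).conjTranspose_mul_mul_same (E t - F t)).trace_nonneg
    have h3 : φ' t = -2 * c * ((E t - F t)ᴴ * (E t * E t - F t * F t)).trace := by
      rw [← Matrix.trace_transpose]
      simp only [hφ', Matrix.trace, Matrix.diag, Matrix.transpose_apply, Matrix.mul_apply (M := (E t - F t)ᴴ),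
        Matrix.conjTranspose_apply, Matrix.sub_apply, star_trivial, Finset.mul_sum]
      rw [Finset.sum_comm]
      refine Finset.sum_congr rfl fun i _ => Finset.sum_congr rfl fun j _ => ?_
      ring
    have h4 : ((E t - F t)ᴴ * (E t * E t - F t * F t)).trace =
        ((E t - F t)ᴴ * E t * (E t - F t)).trace + ((E t - F t)ᴴ * F t * (E t - F t)).trace := by
      rw [hD, Matrix.trace_mul_comm ((E t - F t) * F t), ← Matrix.trace_add]
      congr 1
      noncomm_ring
    rw [h3, h4]
    nlinarith
  have hanti : AntitoneOn φ (Set.Ici 0) := by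
    apply antitoneOn_of_hasDerivWithinAt_nonpos (convex_Ici 0) (f' := φ')
    · exact fun t ht => (hφd t ht).continuousWithinAt
    · exact fun t ht => (hφd t (interior_subset ht)).mono interior_subset
    · exact fun t ht => hφle t (interior_subset ht)
  intro t ht
  have hφ0 : φ 0 = 0 := by simp [hφ, hF, hl0, hE0]
  have h1 : φ t ≤ 0 := hφ0 ▸ hanti (Set.mem_Ici.2 le_rfl) ht ht
  have h2 : φ t = 0 := le_antisymm h1 (by simp only [hφ]; positivity)
  ext i j
  have h3 := (Finset.sum_eq_zero_iff_of_nonneg (fun i _ => by positivity)).1 h2 i (Finset.mem_univ _)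
  have h4 := (Finset.sum_eq_zero_iff_of_nonneg (fun i _ => by positivity)).1 h3 j (Finset.mem_univ _)
  have h5 : E t i j - F t i j = 0 := by simpa using h4
  exact sub_eq_zero.1 h5


end
end
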